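/- arXiv:2505.22975 — 2 statements merged into one kernel-verified Lean document; each statement's English description precedes it below -/
import Mathlib

section
/- Let f : (a,b) → ℝ be a convex function, where a, b ∈ ℝ with a < b. Then for every ε > 0 there exists a convex function g of class C² on (a,b) such that the Lebesgue measure of the set {x ∈ (a,b) : f(x) ≠ g(x)} is less than ε. -/
open MeasureTheory Set

/-- The average of the second derivative of `G` over `[y - r, y + r]` against the hat kernel. -/
noncomputable def hatAvg (G : ℝ → ℝ) (y r : ℝ) : ℝ :=
  (G (y + r) - 2 * G y + G (y - r)) / r ^ 2

/-- The derivative of `y ↦ hatAvg G y (r y)`, where `F` and `r₁` are the derivatives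
of `G` and `r`. -/
noncomputable def hatAvgDeriv (G F : ℝ → ℝ) (y r r₁ : ℝ) : ℝ :=
  (F (y + r) * (1 + r₁) + F (y - r) * (1 - r₁) - 2 * F y) / r ^ 2
    - 2 * r₁ * (G (y + r) - 2 * G y + G (y - r)) / r ^ 3

/-- The second derivative of `y ↦ hatAvg G y (r y)`, where `F`, `f` and `r₁`, `r₂` are the
first and second derivatives of `G` and `r`. -/
noncomputable def hatAvgDeriv2 (G F f : ℝ → ℝ) (y r r₁ r₂ : ℝ) : ℝ :=
  (f (y + r) * (1 + r₁) ^ 2 + f (y - r) * (1 - r₁) ^ 2 - 2 * f y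
      + r₂ * (F (y + r) - F (y - r))) / r ^ 2
    - 4 * r₁ * (F (y + r) * (1 + r₁) + F (y - r) * (1 - r₁) - 2 * F y) / r ^ 3
    + (6 * r₁ ^ 2 / r ^ 4 - 2 * r₂ / r ^ 3) * (G (y + r) - 2 * G y + G (y - r))

lemma hasDerivAt_hatAvg {G F r : ℝ → ℝ} {y r₁ : ℝ} (hr : r y ≠ 0) (hr₁ : HasDerivAt r r₁ y)
    (h₁ : HasDerivAt G (F (y + r y)) (y + r y)) (h₂ : HasDerivAt G (F y) y)
    (h₃ : HasDerivAt G (F (y - r y)) (y - r y)) :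
    HasDerivAt (fun y ↦ hatAvg G y (r y)) (hatAvgDeriv G F y (r y) r₁) y := by
  have a₁ := h₁.comp y ((hasDerivAt_id y).add hr₁)
  have a₃ := h₃.comp y ((hasDerivAt_id y).sub hr₁)
  have := ((a₁.sub (h₂.const_mul 2)).add a₃).div (hr₁.pow 2) (pow_ne_zero 2 hr)
  refine this.congr_deriv ?_
  simp [hatAvgDeriv]
  field_simp
  ring

lemma hasDerivAt_hatAvgDeriv {G F f r r₁ : ℝ → ℝ} {y r₂ : ℝ} (hr : r y ≠ 0)
    (hr₁ : HasDerivAt r (r₁ y) y) (hr₂ : HasDerivAt r₁ r₂ y)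
    (h₁ : HasDerivAt G (F (y + r y)) (y + r y)) (h₂ : HasDerivAt G (F y) y)
    (h₃ : HasDerivAt G (F (y - r y)) (y - r y))
    (k₁ : HasDerivAt F (f (y + r y)) (y + r y)) (k₂ : HasDerivAt F (f y) y)
    (k₃ : HasDerivAt F (f (y - r y)) (y - r y)) :
    HasDerivAt (fun y ↦ hatAvgDeriv G F y (r y) (r₁ y))
      (hatAvgDeriv2 G F f y (r y) (r₁ y) r₂) y := by
  have a₁ := h₁.comp y ((hasDerivAt_id y).add hr₁)
  have a₃ := h₃.comp y ((hasDerivAt_id y).sub hr₁)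
  have b₁ := k₁.comp y ((hasDerivAt_id y).add hr₁)
  have b₃ := k₃.comp y ((hasDerivAt_id y).sub hr₁)
  have c₁ := (((b₁.mul (hr₂.const_add 1)).add (b₃.mul (hr₂.const_sub 1))).sub
    (k₂.const_mul 2)).div (hr₁.pow 2) (pow_ne_zero 2 hr)
  have c₂ := ((hr₂.const_mul 2).mul ((a₁.sub (h₂.const_mul 2)).add a₃)).div (hr₁.pow 3)
    (pow_ne_zero 3 hr)
  refine (c₁.sub c₂).congr_deriv ?_
  simp [hatAvgDeriv2]
  field_simp
  ring

lemma abs_primitive_remainder_le {f F G : ℝ → ℝ} {y r α β γ S : ℝ} (hr : 0 < r)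
    (hG : ∀ z ∈ Icc (y - r) (y + r), HasDerivAt G (F z) z)
    (hF : ∀ z ∈ Icc (y - r) (y + r), HasDerivAt F (f z) z)
    (he : ∀ z ∈ Icc (y - r) (y + r), |f z - (α + β * (z - y) + γ / 2 * (z - y) ^ 2)| ≤ S) :
    ∀ z ∈ Icc (y - r) (y + r),
      |F z - F y - α * (z - y) - β / 2 * (z - y) ^ 2 - γ / 6 * (z - y) ^ 3| ≤ S * r ∧
      |G z - G y - F y * (z - y) - α / 2 * (z - y) ^ 2 - β / 6 * (z - y) ^ 3
        - γ / 24 * (z - y) ^ 4| ≤ S * r * r := by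
  have hy : y ∈ Icc (y - r) (y + r) := by constructor <;> linarith
  have hS : 0 ≤ S := (abs_nonneg _).trans (he y hy)
  have hz : ∀ z ∈ Icc (y - r) (y + r), ‖z - y‖ ≤ r := fun z hz ↦ by
    rw [Real.norm_eq_abs, abs_le]; constructor <;> linarith [hz.1, hz.2]
  have h₁ : ∀ z ∈ Icc (y - r) (y + r),
      |F z - F y - α * (z - y) - β / 2 * (z - y) ^ 2 - γ / 6 * (z - y) ^ 3| ≤ S * r := by
    intro z hzJ
    have := (convex_Icc (y - r) (y + r)).norm_image_sub_le_of_norm_hasDerivWithin_le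
      (f := fun z ↦ F z - F y - α * (z - y) - β / 2 * (z - y) ^ 2 - γ / 6 * (z - y) ^ 3)
      (f' := fun z ↦ f z - (α + β * (z - y) + γ / 2 * (z - y) ^ 2)) (C := S)
      (fun x hx ↦ by
        have i := (hasDerivAt_id x).sub_const y
        have := ((((hF x hx).sub_const (F y)).sub (i.const_mul α)).sub
          ((i.pow 2).const_mul (β / 2))).sub ((i.pow 3).const_mul (γ / 6))
        refine (this.congr_deriv ?_).hasDerivWithinAt
        simp
        ring) he hy hzJ
    simp at this
    exact this.trans (mul_le_mul_of_nonneg_left (hz z hzJ) hS)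
  intro z hzJ
  refine ⟨h₁ z hzJ, ?_⟩
  have := (convex_Icc (y - r) (y + r)).norm_image_sub_le_of_norm_hasDerivWithin_le
    (f := fun z ↦ G z - G y - F y * (z - y) - α / 2 * (z - y) ^ 2 - β / 6 * (z - y) ^ 3
        - γ / 24 * (z - y) ^ 4)
    (f' := fun z ↦ F z - F y - α * (z - y) - β / 2 * (z - y) ^ 2 - γ / 6 * (z - y) ^ 3)
    (C := S * r)
    (fun x hx ↦ by
      have i := (hasDerivAt_id x).sub_const y
      have := (((((hG x hx).sub_const (G y)).sub (i.const_mul (F y))).sub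
        ((i.pow 2).const_mul (α / 2))).sub ((i.pow 3).const_mul (β / 6))).sub
        ((i.pow 4).const_mul (γ / 24))
      refine (this.congr_deriv ?_).hasDerivWithinAt
      simp
      ring) h₁ hy hzJ
  simp at this
  exact this.trans (mul_le_mul_of_nonneg_left (hz z hzJ) (by positivity))

/-- Second-order remainders at `y ± r` of the primitives of `f`, in normalised form. -/
lemma exists_remainders {f F G : ℝ → ℝ} {y r α β γ S : ℝ} (hr : 0 < r)
    (hG : ∀ z ∈ Icc (y - r) (y + r), HasDerivAt G (F z) z)
    (hF : ∀ z ∈ Icc (y - r) (y + r), HasDerivAt F (f z) z)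
    (he : ∀ z ∈ Icc (y - r) (y + r), |f z - (α + β * (z - y) + γ / 2 * (z - y) ^ 2)| ≤ S) :
    ∃ P Q Q', |P| ≤ 2 * S ∧ |Q| ≤ 2 * S ∧ |Q'| ≤ 2 * S ∧
      G (y + r) - 2 * G y + G (y - r) = α * r ^ 2 + γ * r ^ 4 / 12 + P * r ^ 2 ∧
      F (y + r) - F (y - r) = 2 * α * r + γ * r ^ 3 / 3 + Q * r ∧
      F (y + r) + F (y - r) - 2 * F y = β * r ^ 2 + Q' * r := by
  have R := abs_primitive_remainder_le hr hG hF he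
  obtain ⟨p₁, p₂⟩ := R (y + r) (by constructor <;> linarith)
  obtain ⟨m₁, m₂⟩ := R (y - r) (by constructor <;> linarith)
  simp only [add_sub_cancel_left, sub_sub_cancel_left] at p₁ p₂ m₁ m₂
  refine ⟨(G (y + r) - 2 * G y + G (y - r) - α * r ^ 2 - γ * r ^ 4 / 12) / r ^ 2,
    (F (y + r) - F (y - r) - 2 * α * r - γ * r ^ 3 / 3) / r,
    (F (y + r) + F (y - r) - 2 * F y - β * r ^ 2) / r, ?_, ?_, ?_, ?_, ?_, ?_⟩
  · rw [abs_div, div_le_iff₀ (by positivity), abs_of_pos (by positivity : 0 < r ^ 2)]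
    rw [abs_le] at *
    constructor <;> nlinarith
  · rw [abs_div, div_le_iff₀ (by positivity), abs_of_pos hr]
    rw [abs_le] at *
    constructor <;> nlinarith
  · rw [abs_div, div_le_iff₀ (by positivity), abs_of_pos hr]
    rw [abs_le] at *
    constructor <;> nlinarith
  all_goals field_simp; ring

lemma abs_hatAvg_sub_le {f F G : ℝ → ℝ} {y r β S : ℝ} (hr : 0 < r)
    (hG : ∀ z ∈ Icc (y - r) (y + r), HasDerivAt G (F z) z)
    (hF : ∀ z ∈ Icc (y - r) (y + r), HasDerivAt F (f z) z)
    (he : ∀ z ∈ Icc (y - r) (y + r), |f z - (f y + β * (z - y))| ≤ S) :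
    |hatAvg G y r - f y| ≤ 2 * S := by
  obtain ⟨P, Q, Q', hP, -, -, e, -⟩ := exists_remainders (α := f y) (β := β) (γ := 0) (S := S)
    hr hG hF (by simpa using he)
  rw [hatAvg, e]
  convert hP using 2
  field_simp
  ring

lemma abs_hatAvgDeriv_sub_le {f F G : ℝ → ℝ} {y r r₁ β γ S : ℝ} (hr : 0 < r) (h₁ : |r₁| ≤ 1)
    (hG : ∀ z ∈ Icc (y - r) (y + r), HasDerivAt G (F z) z)
    (hF : ∀ z ∈ Icc (y - r) (y + r), HasDerivAt F (f z) z)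
    (he : ∀ z ∈ Icc (y - r) (y + r), |f z - (f y + β * (z - y) + γ / 2 * (z - y) ^ 2)| ≤ S) :
    |hatAvgDeriv G F y r r₁ - (β + γ * r * r₁ / 6)| ≤ 8 * S / r := by
  obtain ⟨P, Q, Q', hP, hQ, hQ', eP, eQ, eQ'⟩ := exists_remainders hr hG hF he
  have : hatAvgDeriv G F y r r₁ - (β + γ * r * r₁ / 6) = (Q' + r₁ * Q - 2 * r₁ * P) / r := by
    have : F (y + r) * (1 + r₁) + F (y - r) * (1 - r₁) - 2 * F y =
      β * r ^ 2 + Q' * r + r₁ * (2 * f y * r + γ * r ^ 3 / 3 + Q * r) := by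
        rw [← eQ, ← eQ']; ring
    rw [hatAvgDeriv, this, eP]
    field_simp
    ring
  rw [this, abs_div, abs_of_pos hr]
  gcongr
  have k₁ : |r₁ * Q| ≤ 2 * S := by
    rw [abs_mul]; nlinarith [abs_nonneg r₁, abs_nonneg Q]
  have k₂ : |r₁ * P| ≤ 2 * S := by
    rw [abs_mul]; nlinarith [abs_nonneg r₁, abs_nonneg P]
  rw [abs_le] at *
  constructor <;> linarith [k₁.1, k₁.2, k₂.1, k₂.2]

/-- The second derivative of the variable-radius average, in terms of the remainders. -/
lemma hatAvgDeriv2_eq {f F G : ℝ → ℝ} {y r r₁ r₂ β γ P Q Q' : ℝ} (hr : 0 < r)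
    (eP : G (y + r) - 2 * G y + G (y - r) = f y * r ^ 2 + γ * r ^ 4 / 12 + P * r ^ 2)
    (eQ : F (y + r) - F (y - r) = 2 * f y * r + γ * r ^ 3 / 3 + Q * r)
    (eQ' : F (y + r) + F (y - r) - 2 * F y = β * r ^ 2 + Q' * r) :
    hatAvgDeriv2 G F f y r r₁ r₂ = γ * (1 + (r₁ ^ 2 + r * r₂) / 6) +
      ((f (y + r) - (f y + β * r + γ / 2 * r ^ 2)) * (1 + r₁) ^ 2
        + (f (y - r) - (f y - β * r + γ / 2 * r ^ 2)) * (1 - r₁) ^ 2 + r * r₂ * Q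
        - 4 * r₁ * (Q' + r₁ * Q) + (6 * r₁ ^ 2 - 2 * (r * r₂)) * P) / r ^ 2 := by
  have : F (y + r) * (1 + r₁) + F (y - r) * (1 - r₁) - 2 * F y =
    β * r ^ 2 + Q' * r + r₁ * (2 * f y * r + γ * r ^ 3 / 3 + Q * r) := by
      rw [← eQ, ← eQ']; ring
  rw [hatAvgDeriv2, this, eP, eQ]
  field_simp
  ring

lemma abs_hatAvgDeriv2_sub_le {f F G : ℝ → ℝ} {y r r₁ r₂ β γ S : ℝ} (hr : 0 < r)
    (h₁ : |r₁| ≤ 1) (h₂ : |r * r₂| ≤ 1)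
    (hG : ∀ z ∈ Icc (y - r) (y + r), HasDerivAt G (F z) z)
    (hF : ∀ z ∈ Icc (y - r) (y + r), HasDerivAt F (f z) z)
    (he : ∀ z ∈ Icc (y - r) (y + r), |f z - (f y + β * (z - y) + γ / 2 * (z - y) ^ 2)| ≤ S) :
    |hatAvgDeriv2 G F f y r r₁ r₂ - γ * (1 + (r₁ ^ 2 + r * r₂) / 6)| ≤ 42 * S / r ^ 2 := by
  obtain ⟨P, Q, Q', hP, hQ, hQ', eP, eQ, eQ'⟩ := exists_remainders hr hG hF he
  have p := he (y + r) (by constructor <;> linarith)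
  have m := he (y - r) (by constructor <;> linarith)
  simp only [add_sub_cancel_left, sub_sub_cancel_left, mul_neg, neg_sq, ← sub_eq_add_neg] at p m
  rw [hatAvgDeriv2_eq hr eP eQ eQ', add_sub_cancel_left, abs_div, abs_of_pos (pow_pos hr 2)]
  gcongr
  have hS := (abs_nonneg _).trans p
  have key : ∀ {u v c s : ℝ}, |u| ≤ c → |v| ≤ s → |u * v| ≤ c * s := fun hu hv ↦ by
    rw [abs_mul]; exact mul_le_mul hu hv (abs_nonneg _) ((abs_nonneg _).trans hu)
  have sq : |r₁| ^ 2 ≤ 1 := by nlinarith [abs_nonneg r₁]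
  rw [sq_abs] at sq
  have k₁ := key (u := (1 + r₁) ^ 2) (c := 4)
    (by rw [abs_le] at h₁; rw [abs_of_nonneg (by positivity)]; nlinarith) p
  have k₂ := key (u := (1 - r₁) ^ 2) (c := 4)
    (by rw [abs_le] at h₁; rw [abs_of_nonneg (by positivity)]; nlinarith) m
  have k₃ := key h₂ hQ
  have k₄ := key h₁ hQ'
  have k₅ := key (u := r₁ ^ 2) (c := 1) (by rw [abs_of_nonneg (by positivity)]; exact sq) hQ
  have k₆ := key (u := r₁ ^ 2) (c := 1) (by rw [abs_of_nonneg (by positivity)]; exact sq) hP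
  have k₇ := key h₂ hP
  rw [abs_le] at k₁ k₂ k₃ k₄ k₅ k₆ k₇ ⊢
  constructor <;> nlinarith only [hS, k₁, k₂, k₃, k₄, k₅, k₆, k₇]

lemma hatAvgDeriv2_nonneg {f F G : ℝ → ℝ} {y r r₁ r₂ β : ℝ} (hr : 0 < r)
    (h₁ : |r₁| ≤ 1 / 100) (h₂ : |r * r₂| ≤ 1 / 100)
    (hG : ∀ z ∈ Icc (y - r) (y + r), HasDerivAt G (F z) z)
    (hF : ∀ z ∈ Icc (y - r) (y + r), HasDerivAt F (f z) z)
    (hf : ConvexOn ℝ (Icc (y - r) (y + r)) f)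
    (hβ : ∀ z ∈ Icc (y - r) (y + r), f y + β * (z - y) ≤ f z) :
    0 ≤ hatAvgDeriv2 G F f y r r₁ r₂ := by
  have hp : y + r ∈ Icc (y - r) (y + r) := by constructor <;> linarith
  have hm : y - r ∈ Icc (y - r) (y + r) := by constructor <;> linarith
  set u := f (y + r) - (f y + β * r) with hu
  set v := f (y - r) - (f y - β * r) with hv
  have hu₀ : 0 ≤ u := by have := hβ _ hp; simp at this; linarith
  have hv₀ : 0 ≤ v := by have := hβ _ hm; simp at this; linarith
  have he : ∀ z ∈ Icc (y - r) (y + r),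
      |f z - (f y + β * (z - y) + 0 / 2 * (z - y) ^ 2)| ≤ u + v := by
    intro z hz
    rw [abs_of_nonneg (by have := hβ z hz; linarith)]
    have hc : ConvexOn ℝ (Icc (y - r) (y + r)) (fun z ↦ f z - β * z) := by
      refine hf.sub ⟨convex_Icc _ _, fun x _ y _ a b _ _ _ ↦ ?_⟩
      simp only [smul_eq_mul]
      apply le_of_eq; ring
    have := hc.le_max_of_mem_Icc hm hp hz
    rcases le_max_iff.1 this with h | h <;> simp only [hu, hv] at * <;> linarith
  obtain ⟨P, Q, Q', hP, hQ, hQ', eP, eQ, eQ'⟩ := exists_remainders hr hG hF he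
  rw [hatAvgDeriv2_eq hr eP eQ eQ', zero_mul, zero_add]
  refine div_nonneg ?_ (by positivity)
  simp only [zero_div, zero_mul, add_zero, ← hu, ← hv]
  have key : ∀ {u v c s : ℝ}, |u| ≤ c → |v| ≤ s → |u * v| ≤ c * s := fun hu hv ↦ by
    rw [abs_mul]; exact mul_le_mul hu hv (abs_nonneg _) ((abs_nonneg _).trans hu)
  have sq : |r₁ ^ 2| ≤ 1 / 10000 := by rw [abs_pow]; nlinarith [abs_nonneg r₁]
  have k₃ := key h₂ hQ
  have k₄ := key h₁ hQ'
  have k₅ := key sq hQ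
  have k₆ := key sq hP
  have k₇ := key h₂ hP
  rw [abs_le] at k₃ k₄ k₅ k₆ k₇ h₁
  have j₁ : 98 / 100 * u ≤ u * (1 + r₁) ^ 2 := by
    rw [mul_comm]; exact mul_le_mul_of_nonneg_left (by nlinarith) hu₀
  have j₂ : 98 / 100 * v ≤ v * (1 - r₁) ^ 2 := by
    rw [mul_comm]; exact mul_le_mul_of_nonneg_left (by nlinarith) hv₀
  nlinarith only [hu₀, hv₀, j₁, j₂, k₃, k₄, k₅, k₆, k₇]

open Filter Topology in
/-- A `C²` gauge on `(0, ∞)` which is sublinear at `0`, yet decays more slowly than a prescribed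
modulus: at scale `u` there is a tolerance `τ` with `u < δ τ` and `τ * u` negligible. -/
lemma exists_slow_gauge (δ : ℝ → ℝ) (hδ : ∀ τ, 0 < τ → 0 < δ τ) :
    ∃ ν ν₁ ν₂ : ℝ → ℝ,
      (∀ u, 0 < u → HasDerivAt ν (ν₁ u) u ∧ HasDerivAt ν₁ (ν₂ u) u ∧ 0 < ν u ∧ ν u ≤ u ∧
        |ν₁ u| ≤ 1 ∧ |u * ν₂ u| ≤ 2) ∧
      ContinuousOn ν₂ (Ioi 0) ∧ Tendsto ν₁ (𝓝[>] 0) (𝓝 0) ∧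
      Tendsto (fun u ↦ u * ν₂ u) (𝓝[>] 0) (𝓝 0) ∧
      ∀ ε, 0 < ε → ∀ᶠ u in 𝓝[>] (0 : ℝ), ∃ τ, 0 < τ ∧ u < δ τ ∧ τ * u ≤ ε * ν u := by
  set d : ℕ → ℝ := fun n ↦ min (δ ((1 / 4) ^ n)) (1 / (n + 1)) with hd
  have d₀ : ∀ n, 0 < d n := fun n ↦ lt_min (hδ _ (by positivity)) (by positivity)
  have d₁ : Tendsto d atTop (𝓝 0) := squeeze_zero (fun n ↦ (d₀ n).le) (fun n ↦ min_le_right _ _)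
    tendsto_one_div_add_atTop_nhds_zero_nat
  set w : ℕ → ℝ := fun n ↦ 1 / 2 / 2 ^ n with hw
  have w₀ : ∀ n, 0 < w n := fun n ↦ by positivity
  have ws : Summable w := summable_geometric_two' 1
  have wt : ∑' n, w n = 1 := tsum_geometric_two' 1
  set h : ℕ → ℝ → ℝ := fun n u ↦ w n * (u ^ 2 / (u + d n)) with hh
  set h₁ : ℕ → ℝ → ℝ := fun n u ↦ w n * (1 - d n ^ 2 / (u + d n) ^ 2) with hh₁
  set h₂ : ℕ → ℝ → ℝ := fun n u ↦ w n * (2 * d n ^ 2 / (u + d n) ^ 3) with hh₂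
  have pos : ∀ n u, 0 < u → 0 < u + d n := fun n u hu ↦ add_pos hu (d₀ n)
  have dh : ∀ n u, 0 < u → HasDerivAt (h n) (h₁ n u) u := fun n u hu ↦ by
    have hp := pos n u hu
    have := (((hasDerivAt_id u).pow 2).div ((hasDerivAt_id u).add_const (d n)) hp.ne').const_mul
      (w n)
    refine this.congr_deriv ?_
    simp [hh₁]
    left
    field_simp
    ring
  have dh₁ : ∀ n u, 0 < u → HasDerivAt (h₁ n) (h₂ n u) u := fun n u hu ↦ by
    have hp := pos n u hu
    have := ((((hasDerivAt_const u (d n ^ 2)).div (((hasDerivAt_id u).add_const (d n)).pow 2)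
      (pow_ne_zero 2 hp.ne')).const_sub 1).const_mul (w n))
    refine this.congr_deriv ?_
    simp [hh₂]
    field_simp
  have b₀ : ∀ n u, 0 < u → 0 ≤ h n u ∧ h n u ≤ w n * u := fun n u hu ↦ by
    have hp := pos n u hu
    refine ⟨mul_nonneg (w₀ n).le (by positivity), mul_le_mul_of_nonneg_left ?_ (w₀ n).le⟩
    rw [div_le_iff₀ hp]; nlinarith [d₀ n]
  have b₁ : ∀ n u, 0 < u → ‖h₁ n u‖ ≤ w n := fun n u hu ↦ by
    have hp := pos n u hu
    have : d n ^ 2 / (u + d n) ^ 2 ≤ 1 := by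
      rw [div_le_one (by positivity)]; nlinarith [d₀ n]
    have h0 : 0 ≤ d n ^ 2 / (u + d n) ^ 2 := by positivity
    rw [hh₁, norm_mul, Real.norm_eq_abs, Real.norm_eq_abs, abs_of_pos (w₀ n),
      abs_of_nonneg (by linarith)]
    exact mul_le_of_le_one_right (w₀ n).le (by linarith)
  have b₂ : ∀ n u, 0 < u → 0 ≤ h₂ n u ∧ u * h₂ n u ≤ 2 * w n := fun n u hu ↦ by
    have hp := pos n u hu
    refine ⟨mul_nonneg (w₀ n).le (div_nonneg (by positivity) (by positivity)), ?_⟩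
    have : u * (2 * d n ^ 2 / (u + d n) ^ 3) ≤ 2 := by
      rw [← mul_div_assoc, div_le_iff₀ (by positivity)]
      have := d₀ n
      have : 0 ≤ u ^ 3 + 3 * u ^ 2 * d n + 2 * u * d n ^ 2 + d n ^ 3 := by positivity
      nlinarith
    calc u * h₂ n u = w n * (u * (2 * d n ^ 2 / (u + d n) ^ 3)) := by rw [hh₂]; ring
      _ ≤ w n * 2 := mul_le_mul_of_nonneg_left this (w₀ n).le
      _ = _ := mul_comm _ _
  have s₀ : ∀ u, 0 < u → Summable fun n ↦ h n u := fun u hu ↦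
    (ws.mul_right u).of_nonneg_of_le (fun n ↦ (b₀ n u hu).1) (fun n ↦ (b₀ n u hu).2)
  have lb : ∀ n u, d n ≤ u → w n * (u / 2) ≤ h n u := fun n u hu ↦ by
    have hu0 := (d₀ n).trans_le hu
    refine mul_le_mul_of_nonneg_left ?_ (w₀ n).le
    rw [le_div_iff₀ (pos n u hu0)]; nlinarith
  have c₂ : ∀ v, 0 < v → ∀ n u, u ∈ Ioi v → ‖h₂ n u‖ ≤ 2 * w n / v := fun v hv n u hu ↦ by
    obtain ⟨p, q⟩ := b₂ n u (hv.trans hu)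
    rw [Real.norm_eq_abs, abs_of_nonneg p, le_div_iff₀ hv]
    nlinarith [mem_Ioi.1 hu]
  have half : ∀ u : ℝ, 0 < u → u ∈ Ioi (u / 2) := fun u hu ↦ by rw [mem_Ioi]; linarith
  have hn0 : ∀ n u, 0 < u → h n u ≤ ∑' n, h n u := fun n u hu ↦
    (s₀ u hu).le_tsum n fun m _ ↦ (b₀ m u hu).1
  have ev : ∀ᶠ u : ℝ in 𝓝[>] 0, 0 < u := self_mem_nhdsWithin
  have id0 : Tendsto (fun u : ℝ ↦ u) (𝓝[>] 0) (𝓝 0) := nhdsWithin_le_nhds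
  refine ⟨fun u ↦ ∑' n, h n u, fun u ↦ ∑' n, h₁ n u, fun u ↦ ∑' n, h₂ n u, fun u hu ↦
    ⟨?_, ?_, ?_, ?_, ?_, ?_⟩, ?_, ?_, ?_, ?_⟩
  · exact hasDerivAt_tsum_of_isPreconnected ws isOpen_Ioi isPreconnected_Ioi
      (fun n y hy ↦ dh n y hy) (fun n y hy ↦ b₁ n y hy) (mem_Ioi.2 hu) (s₀ u hu) (mem_Ioi.2 hu)
  · exact hasDerivAt_tsum_of_isPreconnected ((ws.mul_left 2).div_const (u / 2)) isOpen_Ioi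
      isPreconnected_Ioi (fun n y hy ↦ dh₁ n y ((half_pos hu).trans hy)) (c₂ _ (half_pos hu))
      (half u hu) (ws.of_norm_bounded fun n ↦ b₁ n u hu) (half u hu)
  · refine lt_of_lt_of_le ?_ (hn0 0 u hu)
    have := pos 0 u hu
    have := w₀ 0
    simp only [hh]
    positivity
  · calc ∑' n, h n u ≤ ∑' n, w n * u :=
          (s₀ u hu).tsum_le_tsum (fun n ↦ (b₀ n u hu).2) (ws.mul_right u)
      _ = u := by rw [tsum_mul_right, wt, one_mul]
  · beta_reduce
    rw [← Real.norm_eq_abs, ← wt]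
    exact tsum_of_norm_bounded ws.hasSum fun n ↦ b₁ n u hu
  · beta_reduce
    rw [← Real.norm_eq_abs, ← tsum_mul_left]
    refine (tsum_of_norm_bounded (ws.mul_left 2).hasSum fun n ↦ ?_).trans
      (by rw [tsum_mul_left, wt, mul_one])
    obtain ⟨p, q⟩ := b₂ n u hu
    rwa [Real.norm_eq_abs, abs_of_nonneg (mul_nonneg hu.le p)]
  · intro u hu
    refine ContinuousAt.continuousWithinAt ?_
    refine (continuousOn_tsum (fun n ↦ ?_) ((ws.mul_left 2).div_const (u / 2))
      (c₂ _ (half_pos hu))).continuousAt (Ioi_mem_nhds (half u hu))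
    refine continuousOn_const.mul (continuousOn_const.div (by fun_prop) fun v hv ↦ ?_)
    exact pow_ne_zero 3 (pos n v ((half_pos (mem_Ioi.1 hu)).trans hv)).ne'
  · have := tendsto_tsum_of_dominated_convergence (𝓕 := 𝓝[>] (0 : ℝ)) (f := fun u n ↦ h₁ n u)
      (g := fun _ ↦ 0) ws (fun n ↦ ?_) (ev.mono fun u hu n ↦ b₁ n u hu)
    · simpa using this
    · have hp := d₀ n
      have : ContinuousAt (h₁ n) 0 := by
        refine continuousAt_const.mul (continuousAt_const.sub
          (continuousAt_const.div (by fun_prop) ?_))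
        simp [hp.ne']
      have := this.tendsto.mono_left (nhdsWithin_le_nhds (s := Ioi 0))
      simpa [hh₁, hp.ne'] using this
  · simp_rw [← tsum_mul_left]
    have := tendsto_tsum_of_dominated_convergence (𝓕 := 𝓝[>] (0 : ℝ))
      (f := fun u n ↦ u * h₂ n u) (g := fun _ ↦ 0) (ws.mul_left 2) (fun n ↦ ?_)
      (ev.mono fun u hu n ↦ ?_)
    · simpa using this
    · have hp := d₀ n
      have : ContinuousAt (fun u ↦ u * h₂ n u) 0 := by
        refine continuousAt_id.mul (continuousAt_const.mul
          (continuousAt_const.div (by fun_prop) ?_))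
        simp [hp.ne']
      have := this.tendsto.mono_left (nhdsWithin_le_nhds (s := Ioi 0))
      simpa using this
    · obtain ⟨p, q⟩ := b₂ n u hu
      rwa [Real.norm_eq_abs, abs_of_nonneg (mul_nonneg hu.le p)]
  · intro ε hε
    obtain ⟨N, hN⟩ := exists_pow_lt_of_lt_one (show 0 < ε / 8 by positivity)
      (show (1 / 2 : ℝ) < 1 by norm_num)
    have small : ∀ᶠ u in 𝓝[>] (0 : ℝ), ∀ k ∈ Finset.range (N + 1), u < d k :=
      (Filter.eventually_all_finset _).2 fun k _ ↦ id0.eventually (gt_mem_nhds (d₀ k))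
    filter_upwards [ev, small] with u hu hs
    have ex : ∃ n, d n ≤ u := ((d₁.eventually (gt_mem_nhds hu)).exists).imp fun n hn ↦ hn.le
    classical
    obtain ⟨n, hn, hmin⟩ : ∃ n, d n ≤ u ∧ ∀ m < n, u < d m :=
      ⟨Nat.find ex, Nat.find_spec ex, fun m hm ↦ not_le.1 (Nat.find_min ex hm)⟩
    have hNn : N < n := by
      by_contra hc
      exact absurd (hs n (Finset.mem_range.2 (by omega))) (not_lt.2 hn)
    obtain ⟨m, rfl⟩ : ∃ m, n = m + 1 := ⟨n - 1, by omega⟩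
    refine ⟨(1 / 4) ^ m, by positivity, (hmin m (by omega)).trans_le (min_le_left _ _), ?_⟩
    have k := (lb _ u hn).trans (hn0 _ u hu)
    have hm : (1 / 2 : ℝ) ^ m ≤ ε / 8 :=
      (pow_le_pow_of_le_one (by norm_num) (by norm_num) (by omega)).trans hN.le
    have e1 : (1 / 4 : ℝ) ^ m = (1 / 2) ^ m * (1 / 2) ^ m := by rw [← mul_pow]; norm_num
    have e2 : w (m + 1) * (u / 2) = (1 / 2) ^ m * u / 8 := by
      simp only [hw, one_div, inv_pow]; rw [pow_succ]; field_simp; norm_num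
    calc (1 / 4) ^ m * u = (1 / 2) ^ m * ((1 / 2) ^ m * u) := by rw [e1]; ring
      _ ≤ ε / 8 * ((1 / 2) ^ m * u) := mul_le_mul_of_nonneg_right hm (by positivity)
      _ = ε * (w (m + 1) * (u / 2)) := by rw [e2]; ring
      _ ≤ _ := mul_le_mul_of_nonneg_left k hε.le

open Filter Topology in
/-- A smooth substitute for the distance to a closed set `C ⊆ ℝ`, off `C`. -/
lemma IsClosed.exists_regularized_dist {C : Set ℝ} (hC : IsClosed C)
    (hlo : ∀ y, ∃ x ∈ C, x ≤ y) (hhi : ∀ y, ∃ x ∈ C, y ≤ x) :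
    ∃ u u₁ u₂ : ℝ → ℝ, ∀ y ∉ C, HasDerivAt u (u₁ y) y ∧ HasDerivAt u₁ (u₂ y) y ∧
      ContinuousAt u₂ y ∧ 0 < u y ∧ |u₁ y| ≤ 1 ∧ |u y * u₂ y| ≤ 1 ∧
      ∃ x ∈ C, u y ≤ |y - x| ∧ |y - x| ≤ 2 * u y ∧ ∀ x' ∈ C, |y - x| ≤ |y - x'| := by
  set lo : ℝ → ℝ := fun y ↦ sSup (C ∩ Iic y)
  set hi : ℝ → ℝ := fun y ↦ sInf (C ∩ Ici y)
  have lo_ge : ∀ y, ∀ x ∈ C, x ≤ y → x ≤ lo y := fun y x hx hxy ↦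
    le_csSup ⟨y, fun _ h ↦ h.2⟩ ⟨hx, hxy⟩
  have hi_le : ∀ y, ∀ x ∈ C, y ≤ x → hi y ≤ x := fun y x hx hxy ↦
    csInf_le ⟨y, fun _ h ↦ h.2⟩ ⟨hx, hxy⟩
  have lo_mem : ∀ y, lo y ∈ C ∩ Iic y := fun y ↦
    (hC.inter isClosed_Iic).csSup_mem (hlo y) ⟨y, fun _ h ↦ h.2⟩
  have hi_mem : ∀ y, hi y ∈ C ∩ Ici y := fun y ↦
    (hC.inter isClosed_Ici).csInf_mem (hhi y) ⟨y, fun _ h ↦ h.2⟩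
  have lo_lt : ∀ y ∉ C, lo y < y := fun y hy ↦
    lt_of_le_of_ne (lo_mem y).2 fun h ↦ hy (h ▸ (lo_mem y).1)
  have lt_hi : ∀ y ∉ C, y < hi y := fun y hy ↦
    lt_of_le_of_ne (hi_mem y).2 fun h ↦ hy (h ▸ (hi_mem y).1)
  have const : ∀ y ∉ C, ∀ᶠ z in 𝓝 y, lo z = lo y ∧ hi z = hi y := fun y hy ↦ by
    filter_upwards [Ioo_mem_nhds (lo_lt y hy) (lt_hi y hy)] with z hz
    constructor
    · refine le_antisymm ?_ (lo_ge z _ (lo_mem y).1 hz.1.le)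
      rcases le_total (lo z) y with h | h
      · exact lo_ge y _ (lo_mem z).1 h
      · exact absurd (hi_le y _ (lo_mem z).1 h) (not_le.2 ((lo_mem z).2.trans_lt hz.2))
    · refine le_antisymm (hi_le z _ (hi_mem y).1 hz.2.le) ?_
      rcases le_total y (hi z) with h | h
      · exact hi_le y _ (hi_mem z).1 h
      · exact absurd (lo_ge y _ (hi_mem z).1 h) (not_le.2 (hz.1.trans_le (hi_mem z).2))
  refine ⟨fun y ↦ (y - lo y) * (hi y - y) / (hi y - lo y),
    fun y ↦ (lo y + hi y - 2 * y) / (hi y - lo y), fun y ↦ -2 / (hi y - lo y), fun y hy ↦ ?_⟩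
  have h₁ := lo_lt y hy
  have h₂ := lt_hi y hy
  have hev := const y hy
  have hmem₁ := (lo_mem y).1
  have hmem₂ := (hi_mem y).1
  have out : ∀ x ∈ C, x ≤ lo y ∨ hi y ≤ x := fun x hx ↦
    (le_total x y).imp (lo_ge y x hx) (hi_le y x hx)
  beta_reduce
  generalize lo y = c at *
  generalize hi y = d at *
  have hcd : 0 < d - c := by linarith
  have p₁ : 0 < y - c := by linarith
  have p₂ : 0 < d - y := by linarith
  refine ⟨?_, ?_, ?_, by positivity, ?_, ?_, ?_⟩
  · have : HasDerivAt (fun y ↦ (y - c) * (d - y) / (d - c)) ((c + d - 2 * y) / (d - c)) y := by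
      refine ((((hasDerivAt_id y).sub_const c).mul ((hasDerivAt_id y).const_sub d)).div_const
        (d - c)).congr_deriv ?_
      simp
      ring
    exact this.congr_of_eventuallyEq (hev.mono fun z hz ↦ by simp [hz.1, hz.2])
  · have : HasDerivAt (fun y ↦ (c + d - 2 * y) / (d - c)) (-2 / (d - c)) y := by
      refine ((((hasDerivAt_id y).const_mul 2).const_sub (c + d)).div_const (d - c)).congr_deriv ?_
      simp
    exact this.congr_of_eventuallyEq (hev.mono fun z hz ↦ by simp [hz.1, hz.2])
  · have : ContinuousAt (fun _ : ℝ ↦ -2 / (d - c)) y := continuousAt_const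
    exact this.congr (hev.mono fun z hz ↦ by simp [hz.1, hz.2])
  · rw [abs_div, abs_of_pos hcd, div_le_one hcd, abs_le]
    constructor <;> linarith
  · rw [show (y - c) * (d - y) / (d - c) * (-2 / (d - c)) =
      -(2 * ((y - c) * (d - y)) / (d - c) ^ 2) by field_simp, abs_neg, abs_of_pos (by positivity),
      div_le_one (by positivity)]
    nlinarith [sq_nonneg ((y - c) - (d - y))]
  · rcases le_total (y - c) (d - y) with h | h
    · refine ⟨c, hmem₁, ?_, ?_, fun x hx ↦ ?_⟩
      · rw [abs_of_pos p₁, div_le_iff₀ hcd]; nlinarith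
      · rw [abs_of_pos p₁, ← mul_div_assoc, le_div_iff₀ hcd]; nlinarith
      · rw [abs_of_pos p₁]
        rcases out x hx with h' | h'
        · exact (by linarith : y - c ≤ y - x).trans (le_abs_self _)
        · exact (by linarith : y - c ≤ -(y - x)).trans (neg_le_abs _)
    · have e : |y - d| = d - y := by rw [abs_sub_comm, abs_of_pos p₂]
      refine ⟨d, hmem₂, ?_, ?_, fun x hx ↦ ?_⟩
      · rw [e, div_le_iff₀ hcd]; nlinarith
      · rw [e, ← mul_div_assoc, le_div_iff₀ hcd]; nlinarith
      · rw [e]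
        rcases out x hx with h' | h'
        · exact (by linarith : d - y ≤ y - x).trans (le_abs_self _)
        · exact (by linarith : d - y ≤ -(y - x)).trans (neg_le_abs _)

/-- A `C²` radius function off a closed set `C`, which vanishes to higher order at `C`, yet not
faster than a prescribed modulus. -/
lemma IsClosed.exists_slow_radius {C : Set ℝ} (hC : IsClosed C)
    (hlo : ∀ y, ∃ x ∈ C, x ≤ y) (hhi : ∀ y, ∃ x ∈ C, y ≤ x)
    (δ : ℝ → ℝ) (hδ : ∀ τ, 0 < τ → 0 < δ τ) :
    ∃ r r₁ r₂ : ℝ → ℝ,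
      (∀ y ∉ C, HasDerivAt r (r₁ y) y ∧ HasDerivAt r₁ (r₂ y) y ∧ ContinuousAt r₂ y ∧ 0 < r y ∧
        |r₁ y| ≤ 1 / 100 ∧ |r y * r₂ y| ≤ 1 / 100 ∧ ∀ x ∈ C, r y < |y - x|) ∧
      ∀ ε, 0 < ε → ∃ η, 0 < η ∧ ∀ y ∉ C, ∀ x ∈ C, |y - x| < η →
        |r₁ y| ≤ ε ∧ |r y * r₂ y| ≤ ε ∧
        ∃ x' ∈ C, |y - x'| ≤ |y - x| ∧
          ∃ τ, 0 < τ ∧ 2 * |y - x'| < δ τ ∧ τ * |y - x'| ≤ ε * r y := by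
  obtain ⟨u, u₁, u₂, hu⟩ := hC.exists_regularized_dist hlo hhi
  obtain ⟨ν, ν₁, ν₂, hν, cν₂, l₁, l₂, l₃⟩ := exists_slow_gauge (fun τ ↦ δ τ / 4)
    fun τ hτ ↦ div_pos (hδ τ hτ) (by norm_num)
  have bound : ∀ y ∉ C, |1 / 1000 * ν (u y) *
      (1 / 1000 * (ν₂ (u y) * u₁ y ^ 2 + ν₁ (u y) * u₂ y))| ≤
      1 / 1000000 * (|u y * ν₂ (u y)| + |ν₁ (u y)|) := fun y hy ↦ by
    obtain ⟨-, -, -, hu₀, hu₁, hu₂, -⟩ := hu y hy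
    obtain ⟨-, -, n₀, n₁, -, -⟩ := hν (u y) hu₀
    have s : u₁ y ^ 2 ≤ 1 := by rw [← sq_abs]; nlinarith [abs_nonneg (u₁ y)]
    calc _ = 1 / 1000000 * (ν (u y) * |ν₂ (u y) * u₁ y ^ 2 + ν₁ (u y) * u₂ y|) := by
          rw [← abs_of_pos n₀, ← abs_mul, abs_of_pos n₀]
          rw [show (1 : ℝ) / 1000000 = |1 / 1000000| by norm_num, ← abs_mul]
          ring_nf
      _ ≤ 1 / 1000000 * (u y * |ν₂ (u y) * u₁ y ^ 2 + ν₁ (u y) * u₂ y|) := by gcongr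
      _ = 1 / 1000000 * |u y * ν₂ (u y) * u₁ y ^ 2 + ν₁ (u y) * (u y * u₂ y)| := by
          rw [← abs_of_pos hu₀, ← abs_mul, abs_of_pos hu₀]
          ring_nf
      _ ≤ 1 / 1000000 * (|u y * ν₂ (u y)| * 1 + |ν₁ (u y)| * 1) := by
          refine mul_le_mul_of_nonneg_left ((abs_add_le _ _).trans ?_) (by norm_num)
          rw [abs_mul _ (u₁ y ^ 2), abs_mul _ (u y * u₂ y)]
          gcongr
          rwa [abs_of_nonneg (sq_nonneg _)]
      _ = _ := by ring
  refine ⟨fun y ↦ 1 / 1000 * ν (u y), fun y ↦ 1 / 1000 * (ν₁ (u y) * u₁ y),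
    fun y ↦ 1 / 1000 * (ν₂ (u y) * u₁ y ^ 2 + ν₁ (u y) * u₂ y), fun y hy ↦ ?_, fun ε hε ↦ ?_⟩
  · obtain ⟨du, du₁, cu₂, hu₀, hu₁, hu₂, x, hx, e₁, e₂, e₃⟩ := hu y hy
    obtain ⟨dν, dν₁, n₀, n₁, n₂, n₃⟩ := hν (u y) hu₀
    refine ⟨(dν.comp y du).const_mul _, ?_, ?_, by positivity, ?_, ?_, fun x' hx' ↦ ?_⟩
    · refine (((dν₁.comp y du).mul du₁).const_mul _).congr_deriv ?_
      simp; ring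
    · have c₂ : ContinuousAt (fun y ↦ ν₂ (u y)) y :=
        (cν₂.continuousAt (Ioi_mem_nhds hu₀)).comp du.continuousAt
      have c₁ : ContinuousAt (fun y ↦ ν₁ (u y)) y := (dν₁.comp y du).continuousAt
      exact continuousAt_const.mul ((c₂.mul (du₁.continuousAt.pow 2)).add (c₁.mul cu₂))
    · rw [abs_mul, abs_mul, abs_of_pos (by norm_num : (0 : ℝ) < 1 / 1000)]
      nlinarith [abs_nonneg (ν₁ (u y)), abs_nonneg (u₁ y)]
    · exact (bound y hy).trans (by linarith)
    · have := e₃ x' hx'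
      linarith
  · have q₁ := l₁.eventually (Metric.ball_mem_nhds 0 hε)
    have q₂ := l₂.eventually (Metric.ball_mem_nhds 0 hε)
    obtain ⟨η, hη, H⟩ := mem_nhdsGT_iff_exists_Ioo_subset.1
      (q₁.and (q₂.and (l₃ (ε / 2000) (by positivity))))
    refine ⟨η, hη, fun y hy x hx hyx ↦ ?_⟩
    obtain ⟨-, -, -, hu₀, hu₁, hu₂, x', hx', e₁, e₂, e₃⟩ := hu y hy
    obtain ⟨t₁, t₂, τ, hτ, t₃, t₄⟩ := H ⟨hu₀, e₁.trans_lt ((e₃ x hx).trans_lt hyx)⟩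
    simp only [dist_zero_right, Real.norm_eq_abs] at t₁ t₂
    refine ⟨?_, (bound y hy).trans (by linarith), x', hx', e₃ x hx, τ, hτ, by linarith, ?_⟩
    · rw [abs_mul, abs_mul, abs_of_pos (by norm_num : (0 : ℝ) < 1 / 1000)]
      nlinarith [abs_nonneg (ν₁ (u y)), abs_nonneg (u₁ y)]
    · nlinarith

/-- For a monotone function, a first-order bound at rational points extends to all points. -/
lemma MonotoneOn.abs_sub_le_of_forall_rat {φ : ℝ → ℝ} {a b x p η δ : ℝ}
    (hφ : MonotoneOn φ (Ioo a b))
    (h : ∀ q : ℚ, (q : ℝ) ∈ Ioo a b → |q - x| < δ → |φ q - φ x - p * (q - x)| ≤ η * |q - x|)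
    {z : ℝ} (hz : z ∈ Ioo a b) (hzx : |z - x| < δ) :
    |φ z - φ x - p * (z - x)| ≤ η * |z - x| := by
  have near : ∀ᶠ t in nhds z, t ∈ Ioo a b ∧ |t - x| < δ :=
    Filter.Eventually.and (Ioo_mem_nhds hz.1 hz.2)
      ((continuous_abs.comp (continuous_id.sub continuous_const)).continuousAt.eventually
        (gt_mem_nhds hzx))
  rw [abs_le]
  constructor
  · by_contra! hc
    have c : ContinuousAt (fun t ↦ -(η * |t - x|) + φ x + p * (t - x)) z := by fun_prop
    have := near.and (c.eventually (lt_mem_nhds (show φ z < _ by linarith)))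
    obtain ⟨ρ, hρ, H⟩ := Metric.eventually_nhds_iff.1 this
    obtain ⟨q, hq₁, hq₂⟩ := exists_rat_btwn (show z - ρ < z by linarith)
    obtain ⟨⟨k₁, k₂⟩, k₃⟩ := H (show dist (q : ℝ) z < ρ by
      rw [Real.dist_eq, abs_lt]; constructor <;> linarith)
    have := (abs_le.1 (h q k₁ k₂)).1
    have := hφ k₁ hz hq₂.le
    linarith
  · by_contra! hc
    have c : ContinuousAt (fun t ↦ η * |t - x| + φ x + p * (t - x)) z := by fun_prop
    have := near.and (c.eventually (gt_mem_nhds (show _ < φ z by linarith)))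
    obtain ⟨ρ, hρ, H⟩ := Metric.eventually_nhds_iff.1 this
    obtain ⟨q, hq₁, hq₂⟩ := exists_rat_btwn (show z < z + ρ by linarith)
    obtain ⟨⟨k₁, k₂⟩, k₃⟩ := H (show dist (q : ℝ) z < ρ by
      rw [Real.dist_eq, abs_lt]; constructor <;> linarith)
    have := (abs_le.1 (h q k₁ k₂)).2
    have := hφ hz k₁ hq₁.le
    linarith

/-- A monotone function is uniformly differentiable on a compact set of almost full measure. -/
lemma MonotoneOn.exists_isCompact_uniform_deriv {φ : ℝ → ℝ} {a b : ℝ}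
    (hφ : MonotoneOn φ (Ioo a b)) (hm : Measurable φ) {ε : ℝ} (hε : 0 < ε) :
    ∃ (K : Set ℝ) (p : ℝ → ℝ), IsCompact K ∧ K ⊆ Ioo a b ∧
      volume (Ioo a b \ K) < ENNReal.ofReal ε ∧
      ∀ η, 0 < η → ∃ δ, 0 < δ ∧ ∀ x ∈ K, ∀ z ∈ Ioo a b, |z - x| < δ →
        |φ z - φ x - p x * (z - x)| ≤ η * |z - x| := by
  set p := deriv φ with hp
  have hpm : Measurable p := measurable_deriv φ
  set E : ℕ → ℕ → Set ℝ := fun m n ↦ {x | ∀ q : ℚ, (q : ℝ) ∈ Ioo a b → |q - x| < 1 / (n + 1) →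
    |φ q - φ x - p x * (q - x)| ≤ 1 / (m + 1) * |q - x|} with hE
  have Em : ∀ m n, MeasurableSet (E m n) := fun m n ↦ by
    simp only [hE, ofPred_forall]
    refine MeasurableSet.iInter fun q ↦ MeasurableSet.iInter fun _ ↦ ?_
    have e₁ : MeasurableSet {x : ℝ | |(q : ℝ) - x| < 1 / (n + 1)} :=
      measurableSet_lt (by fun_prop) (by fun_prop)
    have e₂ : MeasurableSet {x : ℝ | |φ q - φ x - p x * (q - x)| ≤ 1 / (m + 1) * |q - x|} :=
      measurableSet_le (by fun_prop) (by fun_prop)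
    exact e₁.imp e₂
  have lim : ∀ m, Filter.Tendsto (fun n ↦ volume (Ioo a b \ E m n)) Filter.atTop (nhds 0) := by
    intro m
    have anti : Antitone fun n ↦ Ioo a b \ E m n := fun n n' hn x hx ↦ by
      refine ⟨hx.1, fun hc ↦ hx.2 fun q hq hqx ↦ hc q hq (hqx.trans_le ?_)⟩
      exact one_div_le_one_div_of_le (by positivity) (by exact_mod_cast Nat.succ_le_succ hn)
    have := tendsto_measure_iInter_atTop (μ := volume)
      (fun n ↦ (measurableSet_Ioo.diff (Em m n)).nullMeasurableSet) anti
      ⟨0, ((measure_mono sdiff_subset).trans_lt (by simp)).ne⟩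
    suffices h0 : volume (⋂ n, Ioo a b \ E m n) = 0 by
      rw [h0] at this
      exact this
    have ae := hφ.ae_differentiableWithinAt measurableSet_Ioo
    rw [ae_restrict_iff' measurableSet_Ioo] at ae
    refine measure_mono_null (fun x hx ↦ ?_) (ae_iff.1 ae)
    simp only [mem_iInter, mem_sdiff] at hx
    simp only [mem_ofPred_eq, Classical.not_imp]
    refine ⟨(hx 0).1, fun hd ↦ ?_⟩
    have hd' : HasDerivAt φ (p x) x :=
      (hd.differentiableAt (Ioo_mem_nhds (hx 0).1.1 (hx 0).1.2)).hasDerivAt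
    have := hd'.isLittleO.def (show (0 : ℝ) < 1 / (m + 1) by positivity)
    obtain ⟨ρ, hρ, H⟩ := Metric.eventually_nhds_iff.1 this
    obtain ⟨n, hn⟩ := exists_nat_one_div_lt hρ
    refine (hx n).2 fun q hq hqx ↦ ?_
    have := H (y := q) (by rw [Real.dist_eq]; exact hqx.trans hn)
    simpa [mul_comm] using this
  have hε2 : ENNReal.ofReal (ε / 2) ≠ 0 := by simpa using hε
  obtain ⟨e, he₀, hes⟩ := ENNReal.exists_pos_sum_of_countable' hε2 ℕ
  choose n hn using fun m ↦ ((lim m).eventually (gt_mem_nhds (he₀ m))).exists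
  set A := Ioo a b ∩ ⋂ m, E m (n m) with hA
  have Am : MeasurableSet A := measurableSet_Ioo.inter (MeasurableSet.iInter fun m ↦ Em m (n m))
  obtain ⟨K, hKA, hK, hKv⟩ := Am.exists_isCompact_sdiff_lt
    ((measure_mono inter_subset_left).trans_lt (by simp) : volume A < ⊤).ne hε2
  refine ⟨K, p, hK, hKA.trans inter_subset_left, ?_, fun η hη ↦ ?_⟩
  · have sub : Ioo a b \ K ⊆ (⋃ m, Ioo a b \ E m (n m)) ∪ (A \ K) := fun x hx ↦ by
      by_cases hxA : x ∈ A
      · exact Or.inr ⟨hxA, hx.2⟩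
      · left
        simp only [hA, mem_inter_iff, hx.1, true_and, mem_iInter, not_forall] at hxA
        exact mem_iUnion.2 (hxA.imp fun m h ↦ ⟨hx.1, h⟩)
    calc volume (Ioo a b \ K) ≤ volume (⋃ m, Ioo a b \ E m (n m)) + volume (A \ K) :=
          (measure_mono sub).trans (measure_union_le _ _)
      _ ≤ ∑' m, e m + volume (A \ K) := by
          gcongr
          exact (measure_iUnion_le _).trans (ENNReal.tsum_le_tsum fun m ↦ (hn m).le)
      _ < ENNReal.ofReal (ε / 2) + ENNReal.ofReal (ε / 2) := ENNReal.add_lt_add hes hKv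
      _ = ENNReal.ofReal ε := by
          rw [← ENNReal.ofReal_add (by positivity) (by positivity), add_halves]
  · obtain ⟨m, hm⟩ := exists_nat_one_div_lt hη
    refine ⟨1 / (n m + 1), by positivity, fun x hx z hz hzx ↦ ?_⟩
    have := mem_iInter.1 (hKA hx).2 m
    exact (hφ.abs_sub_le_of_forall_rat this hz hzx).trans
      (mul_le_mul_of_nonneg_right hm.le (abs_nonneg _))

/-- A second-order expansion from a first-order bound on the right derivative. -/
lemma abs_sub_quadratic_le {f φ : ℝ → ℝ} {a b β γ D y z : ℝ} (hc : ContinuousOn f (Ioo a b))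
    (hφ : ∀ x ∈ Ioo a b, HasDerivWithinAt f (φ x) (Ioi x) x) (hy : y ∈ Ioo a b)
    (hz : z ∈ Ioo a b) (hD : ∀ t ∈ uIcc y z, |φ t - (β + γ * (t - y))| ≤ D) :
    |f z - (f y + β * (z - y) + γ / 2 * (z - y) ^ 2)| ≤ D * |z - y| := by
  set h : ℝ → ℝ := fun t ↦ f t - (β * (t - y) + γ / 2 * (t - y) ^ 2) with hh
  have hcont : ContinuousOn h (Ioo a b) := hc.sub (by fun_prop)
  have hderiv : ∀ t ∈ Ioo a b, HasDerivWithinAt h (φ t - (β + γ * (t - y))) (Ici t) t := by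
    intro t ht
    have d : HasDerivAt (fun t ↦ β * (t - y) + γ / 2 * (t - y) ^ 2) (β + γ * (t - y)) t := by
      have i := (hasDerivAt_id t).sub_const y
      refine ((i.const_mul β).add ((i.pow 2).const_mul (γ / 2))).congr_deriv ?_
      simp
      ring
    exact (hasDerivWithinAt_Ioi_iff_Ici.1 (hφ t ht)).sub d.hasDerivWithinAt
  have key : ∀ u v, u ∈ Ioo a b → v ∈ Ioo a b → u ≤ v →
      (∀ t ∈ Icc u v, |φ t - (β + γ * (t - y))| ≤ D) → |h v - h u| ≤ D * (v - u) := by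
    intro u v hu hv huv hb
    have sub : Icc u v ⊆ Ioo a b := fun t ht ↦ ⟨hu.1.trans_le ht.1, ht.2.trans_lt hv.2⟩
    exact norm_image_sub_le_of_norm_deriv_right_le_segment (hcont.mono sub)
      (fun t ht ↦ hderiv t (sub (Ico_subset_Icc_self ht)))
      (fun t ht ↦ hb t (Ico_subset_Icc_self ht)) v (right_mem_Icc.2 huv)
  have e : f z - (f y + β * (z - y) + γ / 2 * (z - y) ^ 2) = h z - h y := by
    simp [hh]
    ring
  rw [e]
  rcases le_total y z with hyz | hyz
  · rw [abs_of_nonneg (sub_nonneg.2 hyz)]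
    exact key y z hy hz hyz fun t ht ↦ hD t (uIcc_of_le hyz ▸ ht)
  · rw [abs_sub_comm, abs_sub_comm z, abs_of_nonneg (sub_nonneg.2 hyz)]
    exact key z y hz hy hyz fun t ht ↦ hD t (uIcc_of_ge hyz ▸ ht)

/-- Off a point `x` at which the right derivative `φ` of `f` has a linear expansion, averages over
radii smaller than the distance to `x` obey the corresponding expansions. -/
lemma hatAvg_expansions {f φ F G : ℝ → ℝ} {a b x y p r r₁ r₂ τ δ : ℝ}
    (hc : ContinuousOn f (Ioo a b)) (hφ : ∀ x ∈ Ioo a b, HasDerivWithinAt f (φ x) (Ioi x) x)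
    (hF : ∀ z ∈ Ioo a b, HasDerivAt F (f z) z) (hG : ∀ z ∈ Ioo a b, HasDerivAt G (F z) z)
    (hx : ∀ z ∈ Ioo a b, |z - x| < δ → |φ z - φ x - p * (z - x)| ≤ τ * |z - x|)
    (hτ : 0 < τ) (hyx : 2 * |y - x| < δ) (hr : 0 < r) (hry : r ≤ |y - x|)
    (hI : Icc (y - r) (y + r) ⊆ Ioo a b) (h₁ : |r₁| ≤ 1) (h₂ : |r * r₂| ≤ 1) :
    |hatAvg G y r - f y| ≤ (4 * τ + |p|) * |y - x| ^ 2 ∧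
      |hatAvgDeriv G F y r r₁ - φ x - p * (y - x)| ≤ (16 * τ + |p| * |r₁|) * |y - x| ∧
      |hatAvgDeriv2 G F f y r r₁ r₂ - p| ≤
        84 * (τ * |y - x|) / r + |p| * (|r₁| + |r * r₂|) := by
  have hy : y ∈ Ioo a b := hI (by constructor <;> linarith)
  have quad : ∀ z ∈ Icc (y - r) (y + r),
      |f z - (f y + (φ x + p * (y - x)) * (z - y) + p / 2 * (z - y) ^ 2)| ≤
        2 * (τ * |y - x|) * r := by
    intro z hz
    have hzy : |z - y| ≤ r := abs_le.2 (by constructor <;> linarith [hz.1, hz.2])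
    refine (abs_sub_quadratic_le (D := 2 * (τ * |y - x|)) hc hφ hy (hI hz) fun t ht ↦ ?_).trans
      (by gcongr)
    have hty : |t - y| ≤ |z - y| := abs_sub_left_of_mem_uIcc ht
    have htI : t ∈ Icc (y - r) (y + r) := by
      have := abs_le.1 (hty.trans hzy)
      constructor <;> linarith
    have htx : |t - x| ≤ 2 * |y - x| := by
      have := abs_sub_le t y x
      linarith
    have := hx t (hI htI) (htx.trans_lt hyx)
    calc _ = |φ t - φ x - p * (t - x)| := by congr 1; ring
      _ ≤ τ * |t - x| := this
      _ ≤ τ * (2 * |y - x|) := by gcongr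
      _ = _ := by ring
  have hG' := fun z hz ↦ hG z (hI hz)
  have hF' := fun z hz ↦ hF z (hI hz)
  refine ⟨?_, ?_, ?_⟩
  · refine (abs_hatAvg_sub_le (S := 2 * (τ * |y - x|) * r + |p| / 2 * r ^ 2)
      (β := φ x + p * (y - x)) hr hG' hF' fun z hz ↦ ?_).trans ?_
    · have hzy : |z - y| ≤ r := abs_le.2 (by constructor <;> linarith [hz.1, hz.2])
      have e : f z - (f y + (φ x + p * (y - x)) * (z - y)) =
        (f z - (f y + (φ x + p * (y - x)) * (z - y) + p / 2 * (z - y) ^ 2)) +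
          p / 2 * (z - y) ^ 2 := by ring
      rw [e]
      refine (abs_add_le _ _).trans (add_le_add (quad z hz) ?_)
      rw [abs_mul, abs_div, abs_two, abs_pow]
      gcongr
    · calc _ ≤ 2 * (2 * (τ * |y - x|) * |y - x| + |p| / 2 * |y - x| ^ 2) := by gcongr
        _ = _ := by ring
  · have k := abs_hatAvgDeriv_sub_le hr h₁ hG' hF' quad
    have e : hatAvgDeriv G F y r r₁ - φ x - p * (y - x) =
      (hatAvgDeriv G F y r r₁ - (φ x + p * (y - x) + p * r * r₁ / 6)) + p * r * r₁ / 6 := by ring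
    rw [e]
    have k₂ : |p * r * r₁ / 6| ≤ |p| * |r₁| * |y - x| := by
      rw [abs_div, abs_mul, abs_mul, abs_of_pos hr, abs_of_pos (by norm_num : (0 : ℝ) < 6)]
      have : |p| * r * |r₁| ≤ |p| * |y - x| * |r₁| := by gcongr
      have := mul_nonneg (mul_nonneg (abs_nonneg p) hr.le) (abs_nonneg r₁)
      linarith
    have k₁ : 8 * (2 * (τ * |y - x|) * r) / r = 16 * τ * |y - x| := by field_simp; ring
    rw [k₁] at k
    linarith [abs_add_le (hatAvgDeriv G F y r r₁ - (φ x + p * (y - x) + p * r * r₁ / 6))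
      (p * r * r₁ / 6)]
  · have k := abs_hatAvgDeriv2_sub_le hr h₁ h₂ hG' hF' quad
    have e : hatAvgDeriv2 G F f y r r₁ r₂ - p =
      (hatAvgDeriv2 G F f y r r₁ r₂ - p * (1 + (r₁ ^ 2 + r * r₂) / 6)) +
        p * ((r₁ ^ 2 + r * r₂) / 6) := by ring
    rw [e]
    refine (abs_add_le _ _).trans (add_le_add (k.trans_eq ?_) ?_)
    · field_simp
      ring
    · rw [abs_mul]
      gcongr
      have s : r₁ ^ 2 ≤ |r₁| := by rw [← sq_abs]; nlinarith [abs_nonneg r₁]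
      rw [abs_div, abs_of_pos (by norm_num : (0 : ℝ) < 6)]
      have := abs_add_le (r₁ ^ 2) (r * r₂)
      rw [abs_of_nonneg (sq_nonneg r₁)] at this
      linarith [abs_nonneg r₁, abs_nonneg (r * r₂)]

lemma hasDerivAt_of_forall_exists {g : ℝ → ℝ} {g' x : ℝ}
    (h : ∀ ε, 0 < ε → ∃ η, 0 < η ∧ ∀ y, |y - x| < η → |g y - g x - g' * (y - x)| ≤ ε * |y - x|) :
    HasDerivAt g g' x := by
  rw [hasDerivAt_iff_isLittleO, Asymptotics.isLittleO_iff]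
  intro ε hε
  obtain ⟨η, hη, H⟩ := h ε hε
  filter_upwards [Metric.ball_mem_nhds x hη] with y hy
  simpa [mul_comm] using H y hy

lemma ContinuousOn.exists_second_antideriv {f : ℝ → ℝ} {a b : ℝ} (hab : a < b)
    (hf : ContinuousOn f (Ioo a b)) :
    ∃ F G : ℝ → ℝ, (∀ z ∈ Ioo a b, HasDerivAt F (f z) z) ∧
      ∀ z ∈ Ioo a b, HasDerivAt G (F z) z := by
  have prim : ∀ u : ℝ → ℝ, ContinuousOn u (Ioo a b) →
      ∃ U : ℝ → ℝ, ∀ z ∈ Ioo a b, HasDerivAt U (u z) z := by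
    intro u hu
    have hm : (a + b) / 2 ∈ Ioo a b := by constructor <;> linarith
    refine ⟨fun z ↦ ∫ t in (a + b) / 2..z, u t, fun z hz ↦ ?_⟩
    refine intervalIntegral.integral_hasDerivAt_right ?_ ?_ ?_
    · exact (hu.mono (ordConnected_Ioo.uIcc_subset hm hz)).intervalIntegrable
    · exact hu.stronglyMeasurableAtFilter isOpen_Ioo z hz
    · exact hu.continuousAt (Ioo_mem_nhds hz.1 hz.2)
  obtain ⟨F, hF⟩ := prim f hf
  obtain ⟨G, hG⟩ := prim F fun z hz ↦ (hF z hz).continuousAt.continuousWithinAt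
  exact ⟨F, G, hF, hG⟩

lemma ConvexOn.add_rightDeriv_mul_le {f : ℝ → ℝ} {a b y z : ℝ} (hf : ConvexOn ℝ (Ioo a b) f)
    (hy : y ∈ Ioo a b) (hz : z ∈ Ioo a b) : f y + derivWithin f (Ioi y) y * (z - y) ≤ f z := by
  have hy' : y ∈ interior (Ioo a b) := by rwa [interior_Ioo]
  rcases lt_trichotomy y z with h | rfl | h
  · have := hf.rightDeriv_le_slope_of_mem_interior hy' hz h
    rw [slope_def_field, le_div_iff₀ (sub_pos.2 h)] at this
    linarith
  · simp
  · have := (hf.slope_le_leftDeriv_of_mem_interior hz hy' h).trans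
      (hf.leftDeriv_le_rightDeriv_of_mem_interior hy')
    rw [slope_def_field, div_le_iff₀ (sub_pos.2 h)] at this
    linarith

/-- A convex function whose right derivative is uniformly differentiable on a compact set `K`
agrees on `K` with a function which is twice continuously differentiable and has nonnegative second
derivative. -/
lemma ConvexOn.exists_C2_eqOn {f p : ℝ → ℝ} {a b : ℝ} {K : Set ℝ} (hab : a < b)
    (hf : ConvexOn ℝ (Ioo a b) f) (hK : IsCompact K) (hKI : K ⊆ Ioo a b)
    (hp : ∀ τ, 0 < τ → ∃ δ, 0 < δ ∧ ∀ x ∈ K, ∀ z ∈ Ioo a b, |z - x| < δ →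
      |derivWithin f (Ioi z) z - derivWithin f (Ioi x) x - p x * (z - x)| ≤ τ * |z - x|) :
    ∃ g g₁ g₂ : ℝ → ℝ, EqOn f g K ∧ ∀ x ∈ Ioo a b,
      HasDerivAt g (g₁ x) x ∧ HasDerivAt g₁ (g₂ x) x ∧ ContinuousAt g₂ x ∧ 0 ≤ g₂ x := by
  classical
  have mono : MonotoneOn (fun x ↦ derivWithin f (Ioi x) x) (Ioo a b) := by
    simpa using hf.monotoneOn_rightDeriv
  have hφ : ∀ x ∈ Ioo a b, HasDerivWithinAt f (derivWithin f (Ioi x) x) (Ioi x) x := fun x hx ↦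
    hf.hasDerivWithinAt_rightDeriv_of_mem_interior (by rwa [interior_Ioo])
  have hsub := fun y hy z hz ↦ hf.add_rightDeriv_mul_le (y := y) (z := z) hy hz
  set φ : ℝ → ℝ := fun x ↦ derivWithin f (Ioi x) x
  have hc : ContinuousOn f (Ioo a b) := hf.continuousOn isOpen_Ioo
  obtain ⟨F, G, hF, hG⟩ := hc.exists_second_antideriv hab
  choose! δ hδ hexp using hp
  set C : Set ℝ := K ∪ (Ioo a b)ᶜ
  have hCclosed : IsClosed C := hK.isClosed.union isOpen_Ioo.isClosed_compl
  have mem_K : ∀ x ∈ C, x ∈ Ioo a b → x ∈ K := fun x hx hx' ↦ hx.resolve_right fun h ↦ h hx'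
  have hKC : K ⊆ C := subset_union_left
  obtain ⟨r, r₁, r₂, hr, hslow⟩ := hCclosed.exists_slow_radius
    (fun y ↦ ⟨min a y, Or.inr fun h ↦ (min_le_left a y).not_gt h.1, min_le_right _ _⟩)
    (fun y ↦ ⟨max b y, Or.inr fun h ↦ (le_max_left b y).not_gt h.2, le_max_right _ _⟩) δ hδ
  have hI : ∀ y ∉ C, Icc (y - r y) (y + r y) ⊆ Ioo a b := by
    intro y hy z hz
    by_contra hzI
    have h := (hr y hy).2.2.2.2.2.2 z (Or.inr hzI)
    exact h.not_ge (abs_le.2 (by constructor <;> linarith [hz.1, hz.2]))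
  have hyI : ∀ y ∉ C, y ∈ Ioo a b := fun y hy ↦ by_contra fun h ↦ hy (Or.inr h)
  set g : ℝ → ℝ := fun y ↦ if y ∈ C then f y else hatAvg G y (r y)
  set g₁ : ℝ → ℝ := fun y ↦ if y ∈ C then φ y else hatAvgDeriv G F y (r y) (r₁ y)
  set g₂ : ℝ → ℝ := fun y ↦ if y ∈ C then p y else
    hatAvgDeriv2 G F f y (r y) (r₁ y) (r₂ y)
  have gC : ∀ y ∈ C, g y = f y := fun y hy ↦ if_pos hy
  have g₁C : ∀ y ∈ C, g₁ y = φ y := fun y hy ↦ if_pos hy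
  have g₂C : ∀ y ∈ C, g₂ y = p y := fun y hy ↦ if_pos hy
  have gN : ∀ y ∉ C, g y = hatAvg G y (r y) := fun y hy ↦ if_neg hy
  have g₁N : ∀ y ∉ C, g₁ y = hatAvgDeriv G F y (r y) (r₁ y) := fun y hy ↦ if_neg hy
  have g₂N : ∀ y ∉ C, g₂ y = hatAvgDeriv2 G F f y (r y) (r₁ y) (r₂ y) := fun y hy ↦ if_neg hy
  have expansions : ∀ x ∈ K, ∀ y ∉ C, ∀ τ, 0 < τ → 2 * |y - x| < δ τ →
      |g y - f y| ≤ (4 * τ + |p x|) * |y - x| ^ 2 ∧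
      |g₁ y - φ x - p x * (y - x)| ≤ (16 * τ + |p x| * |r₁ y|) * |y - x| ∧
      |g₂ y - p x| ≤ 84 * (τ * |y - x|) / r y + |p x| * (|r₁ y| + |r y * r₂ y|) := by
    intro x hx y hy τ hτ hyx
    obtain ⟨-, -, -, hr₀, hr₁, hr₂, hlt⟩ := hr y hy
    rw [gN y hy, g₁N y hy, g₂N y hy]
    exact hatAvg_expansions hc hφ hF hG (hexp τ hτ x hx) hτ hyx hr₀ (hlt x (hKC hx)).le (hI y hy)
      (hr₁.trans (by norm_num)) (hr₂.trans (by norm_num))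
  have inner : ∀ x ∈ K, ∃ η, 0 < η ∧ ∀ y, |y - x| < η → y ∈ Ioo a b := by
    intro x hx
    obtain ⟨η, hη, h⟩ := Metric.isOpen_iff.1 isOpen_Ioo x (hKI hx)
    exact ⟨η, hη, fun y hy ↦ h (by rwa [Metric.mem_ball, Real.dist_eq])⟩
  have p_near : ∀ x ∈ K, ∀ y ∈ K, ∀ τ, 0 < τ → |y - x| < δ τ → |p y - p x| ≤ 2 * τ := by
    intro x hx y hy τ hτ hyx
    rcases eq_or_ne y x with rfl | hne
    · simpa using hτ.le
    have hpos : 0 < |y - x| := abs_pos.2 (sub_ne_zero.2 hne)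
    have h₁ := hexp τ hτ x hx y (hKI hy) hyx
    have h₂ := hexp τ hτ y hy x (hKI hx) (by rwa [abs_sub_comm])
    rw [abs_sub_comm x y] at h₂
    refine le_of_mul_le_mul_right ?_ hpos
    rw [← abs_mul]
    calc |(p y - p x) * (y - x)|
        = |(φ y - φ x - p x * (y - x)) + (φ x - φ y - p y * (x - y))| := by congr 1; ring
      _ ≤ τ * |y - x| + τ * |y - x| := (abs_add_le _ _).trans (add_le_add h₁ h₂)
      _ = _ := by ring
  refine ⟨g, g₁, g₂, fun x hx ↦ (gC x (hKC hx)).symm, fun x hxI ↦ ?_⟩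
  by_cases hxC : x ∈ C
  · have hx := mem_K x hxC hxI
    obtain ⟨η, hη, hηI⟩ := inner x hx
    refine ⟨?_, ?_, ?_, ?_⟩
    · rw [g₁C x hxC]
      refine hasDerivAt_of_forall_exists fun ε hε ↦ ?_
      have hM : 0 < 5 + 2 * |p x| := by positivity
      refine ⟨min (min η (δ 1 / 2)) (ε / (5 + 2 * |p x|)),
        lt_min (lt_min hη (half_pos (hδ 1 one_pos))) (div_pos hε hM), fun y hy ↦ ?_⟩
      obtain ⟨⟨h₁, h₂⟩, h₃⟩ : (|y - x| < η ∧ |y - x| < δ 1 / 2) ∧ _ := by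
        simpa only [lt_min_iff] using hy
      rw [lt_div_iff₀ hM] at h₃
      have hyI' := hηI y h₁
      have t := abs_sub_quadratic_le (f := f) (β := φ x) (γ := p x) (D := 1 * |y - x|) hc hφ hxI
        hyI' fun t ht ↦ by
          have hty : |t - x| ≤ |y - x| := abs_sub_left_of_mem_uIcc ht
          have := hexp 1 one_pos x hx t (hηI t (hty.trans_lt h₁)) (by linarith [abs_nonneg (y - x)])
          calc _ = |φ t - φ x - p x * (t - x)| := by congr 1; ring
            _ ≤ _ := this.trans (by gcongr)
      have s : |g y - f y| ≤ (4 + |p x|) * |y - x| ^ 2 := by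
        by_cases hy : y ∈ C
        · rw [gC y hy, sub_self, abs_zero]
          positivity
        · simpa using (expansions x hx y hy 1 one_pos (by linarith)).1
      rw [gC x hxC]
      have q : |p x / 2 * (y - x) ^ 2| ≤ |p x| * |y - x| ^ 2 := by
        rw [abs_mul, abs_div, abs_two, abs_pow]
        gcongr
        linarith [abs_nonneg (p x)]
      calc |g y - f x - φ x * (y - x)|
          = |(g y - f y) + (f y - (f x + φ x * (y - x) + p x / 2 * (y - x) ^ 2)) +
              p x / 2 * (y - x) ^ 2| := by congr 1; ring
        _ ≤ (4 + |p x|) * |y - x| ^ 2 + 1 * |y - x| * |y - x| + |p x| * |y - x| ^ 2 :=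
            (abs_add_le _ _).trans (add_le_add ((abs_add_le _ _).trans (add_le_add s t)) q)
        _ = |y - x| * (5 + 2 * |p x|) * |y - x| := by ring
        _ ≤ ε * |y - x| := by gcongr
    · rw [g₂C x hxC]
      refine hasDerivAt_of_forall_exists fun ε hε ↦ ?_
      have hM : 0 < 2 * (|p x| + 1) := by positivity
      have hτ : 0 < ε / 32 := by positivity
      obtain ⟨η', hη', H⟩ := hslow (ε / (2 * (|p x| + 1))) (div_pos hε hM)
      refine ⟨min (min η (δ (ε / 32) / 2)) η',
        lt_min (lt_min hη (half_pos (hδ _ hτ))) hη', fun y hy ↦ ?_⟩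
      obtain ⟨⟨h₁, h₂⟩, h₃⟩ : (|y - x| < η ∧ |y - x| < δ (ε / 32) / 2) ∧ _ := by
        simpa only [lt_min_iff] using hy
      rw [g₁C x hxC]
      by_cases hyC : y ∈ C
      · rw [g₁C y hyC]
        refine (hexp _ hτ x hx y (hηI y h₁) (by linarith [abs_nonneg (y - x)])).trans ?_
        gcongr
        linarith
      · refine (expansions x hx y hyC _ hτ (by linarith)).2.1.trans ?_
        have k := (H y hyC x hxC h₃).1
        rw [le_div_iff₀ hM] at k
        gcongr
        nlinarith [abs_nonneg (r₁ y)]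
    · rw [Metric.continuousAt_iff]
      intro ε hε
      have hM : 0 < 91 + 2 * |p x| := by positivity
      obtain ⟨e, he, he₁, heε⟩ : ∃ e : ℝ, 0 < e ∧ e ≤ 1 ∧ e * (91 + 2 * |p x|) ≤ ε :=
        ⟨min 1 (ε / (91 + 2 * |p x|)), lt_min one_pos (div_pos hε hM), min_le_left _ _,
          (le_div_iff₀ hM).1 (min_le_right _ _)⟩
      obtain ⟨η', hη', H⟩ := hslow e he
      refine ⟨min (min (η / 2) (δ e / 2)) η',
        lt_min (lt_min (half_pos hη) (half_pos (hδ e he))) hη', fun y hy ↦ ?_⟩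
      rw [Real.dist_eq] at hy ⊢
      obtain ⟨⟨h₁, h₂⟩, h₃⟩ : (|y - x| < η / 2 ∧ |y - x| < δ e / 2) ∧ _ := by
        simpa only [lt_min_iff] using hy
      have near : ∀ x' ∈ C, |y - x'| ≤ |y - x| → x' ∈ K ∧ |p x' - p x| ≤ 2 * e := by
        intro x' hx' hle
        have hd : |x' - x| ≤ 2 * |y - x| := by
          have := abs_sub_le x' y x
          rw [abs_sub_comm x' y] at this
          linarith
        have hx'K := mem_K x' hx' (hηI x' (by linarith))
        exact ⟨hx'K, p_near x hx x' hx'K e he (by linarith)⟩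
      rw [g₂C x hxC]
      by_cases hyC : y ∈ C
      · rw [g₂C y hyC]
        have := (near y hyC (by simp)).2
        nlinarith [abs_nonneg (p x)]
      · obtain ⟨k₁, k₂, x', hx', hle, τ, hτ, k₃, k₄⟩ := H y hyC x hxC h₃
        obtain ⟨hx'K, hpp⟩ := near x' hx' hle
        have hr₀ : 0 < r y := (hr y hyC).2.2.2.1
        have t := (expansions x' hx'K y hyC τ hτ k₃).2.2
        have u : 84 * (τ * |y - x'|) / r y ≤ 84 * e := by
          rw [div_le_iff₀ hr₀]
          linarith
        have v : |p x'| ≤ |p x| + 2 := by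
          have := abs_sub_abs_le_abs_sub (p x') (p x)
          linarith
        have w : |p x'| * (|r₁ y| + |r y * r₂ y|) ≤ (|p x| + 2) * (e + e) := by gcongr
        have z := abs_sub_le (g₂ y) (p x') (p x)
        nlinarith [abs_nonneg (p x)]
    · rw [g₂C x hxC]
      refine le_of_forall_pos_le_add fun τ hτ ↦ ?_
      obtain ⟨s, hs, hs'⟩ := exists_between (lt_min hη (hδ τ hτ))
      have e : |x + s - x| = s := by rw [add_sub_cancel_left, abs_of_pos hs]
      have hxs := hηI (x + s) (by rw [e]; exact hs'.trans_le (min_le_left _ _))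
      have h := hexp τ hτ x hx _ hxs (by rw [e]; exact hs'.trans_le (min_le_right _ _))
      have h' := mono hxI hxs (by linarith)
      rw [e, add_sub_cancel_left] at h
      change φ x ≤ φ (x + s) at h'
      refine le_of_mul_le_mul_right ?_ hs
      linarith [(abs_le.1 h).2]
  · obtain ⟨dr, dr₁, cr₂, hr₀, hr₁, hr₂, -⟩ := hr x hxC
    have ev : ∀ᶠ y in nhds x, y ∉ C := hCclosed.isOpen_compl.mem_nhds hxC
    have m₀ : x ∈ Ioo a b := hxI
    have m₁ : x + r x ∈ Ioo a b := hI x hxC (by constructor <;> linarith)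
    have m₂ : x - r x ∈ Ioo a b := hI x hxC (by constructor <;> linarith)
    refine ⟨?_, ?_, ?_, ?_⟩
    · rw [g₁N x hxC]
      exact (hasDerivAt_hatAvg hr₀.ne' dr (hG _ m₁) (hG _ m₀) (hG _ m₂)).congr_of_eventuallyEq
        (ev.mono gN)
    · rw [g₂N x hxC]
      exact (hasDerivAt_hatAvgDeriv hr₀.ne' dr dr₁ (hG _ m₁) (hG _ m₀) (hG _ m₂) (hF _ m₁)
        (hF _ m₀) (hF _ m₂)).congr_of_eventuallyEq (ev.mono g₁N)
    · have cF : ∀ z ∈ Ioo a b, ContinuousAt F z := fun z hz ↦ (hF z hz).continuousAt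
      have cG : ∀ z ∈ Ioo a b, ContinuousAt G z := fun z hz ↦ (hG z hz).continuousAt
      have cf : ∀ z ∈ Ioo a b, ContinuousAt f z := fun z hz ↦
        hc.continuousAt (Ioo_mem_nhds hz.1 hz.2)
      have cr := dr.continuousAt
      have cr₁ := dr₁.continuousAt
      have plus : ∀ u : ℝ → ℝ, ContinuousAt u (x + r x) → ContinuousAt (fun y ↦ u (y + r y)) x :=
        fun u hu ↦ ContinuousAt.comp (f := fun y ↦ y + r y) hu (continuousAt_id.add cr)
      have minus : ∀ u : ℝ → ℝ, ContinuousAt u (x - r x) → ContinuousAt (fun y ↦ u (y - r y)) x :=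
        fun u hu ↦ ContinuousAt.comp (f := fun y ↦ y - r y) hu (continuousAt_id.sub cr)
      have f₁ := plus f (cf _ m₁)
      have f₂ := minus f (cf _ m₂)
      have f₀ := cf _ m₀
      have F₁ := plus F (cF _ m₁)
      have F₂ := minus F (cF _ m₂)
      have F₀ := cF _ m₀
      have G₁ := plus G (cG _ m₁)
      have G₂ := minus G (cG _ m₂)
      have G₀ := cG _ m₀
      have n := hr₀.ne'
      refine ContinuousAt.congr ?_ (ev.mono fun y hy ↦ (g₂N y hy).symm)
      unfold hatAvgDeriv2
      fun_prop (disch := positivity)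
    · rw [g₂N x hxC]
      exact hatAvgDeriv2_nonneg hr₀ hr₁ hr₂ (fun z hz ↦ hG z (hI x hxC hz))
        (fun z hz ↦ hF z (hI x hxC hz)) (hf.subset (hI x hxC) (convex_Icc _ _))
        fun z hz ↦ hsub x m₀ z (hI x hxC hz)

/-- **Lemma 4 (special case).** Let `f : (a,b) → ℝ` be convex, `a, b ∈ ℝ`, `a < b`. Then for
every `ε > 0` there is a convex function `g ∈ C²(a,b)` with `|{x ∈ (a,b) : f x ≠ g x}| < ε`. -/
theorem convex_lusin_C2_bounded (a b : ℝ) (hab : a < b) (f : ℝ → ℝ)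
    (hf : ConvexOn ℝ (Ioo a b) f) (ε : ℝ) (hε : 0 < ε) :
    ∃ g : ℝ → ℝ,
      ConvexOn ℝ (Ioo a b) g ∧
      ContDiffOn ℝ 2 g (Ioo a b) ∧
      volume {x ∈ Ioo a b | f x ≠ g x} < ENNReal.ofReal ε := by
  obtain ⟨K, p, hK, hKI, hvol, hp⟩ := MonotoneOn.exists_isCompact_uniform_deriv
    (by simpa using hf.monotoneOn_rightDeriv) (measurable_derivWithin_Ioi f) hε
  obtain ⟨g, g₁, g₂, hfg, hg⟩ := hf.exists_C2_eqOn hab hK hKI hp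
  have cont : ContinuousOn g (Ioo a b) := fun x hx ↦
    (hg x hx).1.continuousAt.continuousWithinAt
  have d₁ : EqOn (deriv g) g₁ (Ioo a b) := fun x hx ↦ (hg x hx).1.deriv
  have d₂ : EqOn (deriv g₁) g₂ (Ioo a b) := fun x hx ↦ (hg x hx).2.1.deriv
  refine ⟨g, ?_, ?_, ?_⟩
  · refine convexOn_of_hasDerivWithinAt2_nonneg (f' := g₁) (f'' := g₂) (convex_Ioo a b) cont ?_ ?_ ?_
      <;> rw [interior_Ioo] <;> intro x hx
    · exact (hg x hx).1.hasDerivWithinAt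
    · exact (hg x hx).2.1.hasDerivWithinAt
    · exact (hg x hx).2.2.2
  · rw [show (2 : WithTop ℕ∞) = 1 + 1 by norm_num, contDiffOn_succ_iff_deriv_of_isOpen isOpen_Ioo]
    refine ⟨fun x hx ↦ (hg x hx).1.differentiableAt.differentiableWithinAt, by simp,
      ContDiffOn.congr ?_ d₁⟩
    rw [show (1 : WithTop ℕ∞) = 0 + 1 by norm_num, contDiffOn_succ_iff_deriv_of_isOpen isOpen_Ioo]
    refine ⟨fun x hx ↦ (hg x hx).2.1.differentiableAt.differentiableWithinAt, by simp,
      contDiffOn_zero.2 (ContinuousOn.congr (fun x hx ↦ ?_) d₂)⟩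
    exact (hg x hx).2.2.1.continuousWithinAt
  · refine (measure_mono ?_).trans_lt hvol
    exact fun x hx ↦ ⟨hx.1, fun hxK ↦ hx.2 (hfg hxK)⟩
end

section
/- Let U ⊆ ℝⁿ be open and convex, and let f : U → ℝ be a convex function that is not of class C¹'¹_loc on U. Then the following are equivalent: (1) for every ε > 0 there exists a convex function g of class C¹'¹_loc on U such that the Lebesgue measure of {x ∈ U : f(x) ≠ g(x)} is less than ε; (2) the graph of f, i.e. the set {(x, f(x)) : x ∈ U} ⊆ ℝⁿ⁺¹, does not contain any full line (a set of the form {p + t·d : t ∈ ℝ} with d ≠ 0). Moreover, if the graph of f contains no lines, then for every ε > 0 such a function g can be found satisfying g ≥ f on U. -/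
open MeasureTheory Set

/-- `f` is of class `C¹'¹_loc` on the open set `U`: it is differentiable on `U` and its
derivative is locally Lipschitz on `U`. -/
def IsC11LocOn {n : ℕ} (U : Set (EuclideanSpace ℝ (Fin n)))
    (f : EuclideanSpace ℝ (Fin n) → ℝ) : Prop :=
  ∃ f' : EuclideanSpace ℝ (Fin n) → (EuclideanSpace ℝ (Fin n) →L[ℝ] ℝ),
    (∀ x ∈ U, HasFDerivAt f (f' x) x) ∧
    ∀ x ∈ U, ∃ (K : NNReal) (r : ℝ), 0 < r ∧ LipschitzOnWith K f' (Metric.ball x r ∩ U)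

section Preliminaries

open Filter Topology
open scoped RealInnerProductSpace

section ConvexAnalysis

variable {E : Type*} [NormedAddCommGroup E] [InnerProductSpace ℝ E]

theorem norm_le_of_inner_le_of_norm_eq {a : E} {M δ : ℝ} (hδ : 0 < δ) (hM : 0 ≤ M)
    (h : ∀ w : E, ‖w‖ = δ → ⟪a, w⟫ ≤ M * δ) : ‖a‖ ≤ M := by
  rcases eq_or_ne a 0 with rfl | ha
  · simpa
  have ha' : 0 < ‖a‖ := norm_pos_iff.2 ha
  have := h ((δ / ‖a‖) • a) (by
    rw [norm_smul, Real.norm_of_nonneg (by positivity)]; field_simp)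
  rw [real_inner_smul_right, real_inner_self_eq_norm_sq] at this
  have e : δ / ‖a‖ * ‖a‖ ^ 2 = ‖a‖ * δ := by field_simp
  rw [e] at this
  exact le_of_mul_le_mul_right this hδ

variable [FiniteDimensional ℝ E]

/-- A convex function on an open set has a subgradient at every point. -/
theorem ConvexOn.exists_subgradient {U : Set E} {f : E → ℝ} (hU : IsOpen U)
    (hf : ConvexOn ℝ U f) {x : E} (hx : x ∈ U) :
    ∃ p : E, ∀ y ∈ U, f x + ⟪p, y - x⟫ ≤ f y := by
  have hcont : ContinuousOn f U := hf.continuousOn hU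
  have hopen : IsOpen {q : E × ℝ | q.1 ∈ U ∧ f q.1 < q.2} := by
    have h1 : ContinuousOn (fun q : E × ℝ => q.2 - f q.1) (U ×ˢ univ) :=
      continuousOn_snd.sub (hcont.comp continuousOn_fst fun q hq => hq.1)
    have h2 := h1.isOpen_inter_preimage (hU.prod isOpen_univ) (isOpen_Ioi (a := (0 : ℝ)))
    convert h2 using 1
    ext q; simp
  obtain ⟨F, hF⟩ := geometric_hahn_banach_open_point hf.convex_strict_epigraph hopen
    (x := (x, f x)) (by simp)
  set G : E →L[ℝ] ℝ := F.comp (ContinuousLinearMap.inl ℝ E ℝ) with hG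
  set c : ℝ := F (0, 1) with hc
  have hsplit : ∀ v s, F (v, s) = G v + s * c := by
    intro v s
    have : ((v, s) : E × ℝ) = (v, 0) + s • (0, 1) := by simp
    rw [this, map_add, map_smul]; simp [hG, hc]
  have hc0 : c < 0 := by
    have := hF (x, f x + 1) ⟨hx, by simp⟩
    rw [hsplit, hsplit] at this; linarith
  refine ⟨(-c)⁻¹ • (InnerProductSpace.toDual ℝ E).symm G, fun y hy => ?_⟩
  rw [real_inner_smul_left, InnerProductSpace.toDual_symm_apply, map_sub]
  have key : G y + f y * c ≤ G x + f x * c := by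
    refine le_of_forall_pos_lt_add fun δ hδ => ?_
    have := hF (y, f y + δ / (-c)) ⟨hy, by simpa using div_pos hδ (neg_pos.2 hc0)⟩
    rw [hsplit, hsplit] at this
    have e : (f y + δ / (-c)) * c = f y * c - δ := by field_simp [hc0.ne]; ring
    linarith
  have hnc : 0 < -c := neg_pos.2 hc0
  have : (-c)⁻¹ * (G y - G x) ≤ f y - f x := by
    rw [inv_mul_le_iff₀ hnc]; nlinarith
  linarith

/-- The symmetric second differences of `f` are locally bounded by a quadratic near `x₀`. -/
def HasSecondDiffBoundAt (f : E → ℝ) (x₀ : E) : Prop :=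
  ∃ Λ r : ℝ, 0 ≤ Λ ∧ 0 < r ∧ ∀ x ∈ Metric.ball x₀ r, ∀ v : E, ‖v‖ < r →
    f (x + v) + f (x - v) - 2 * f x ≤ Λ * ‖v‖ ^ 2

end ConvexAnalysis

section SecondDifference

theorem HasSecondDiffBoundAt.congr {E : Type*} [NormedAddCommGroup E] {f g : E → ℝ} {x₀ : E}
    (hf : HasSecondDiffBoundAt f x₀) (h : f =ᶠ[𝓝 x₀] g) : HasSecondDiffBoundAt g x₀ := by
  obtain ⟨Λ, r, hΛ, hr, H⟩ := hf
  obtain ⟨s, hs, hfg⟩ := Metric.eventually_nhds_iff_ball.1 h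
  refine ⟨Λ, min r (s / 2), hΛ, by positivity, fun x hx v hv => ?_⟩
  have hx1 : dist x x₀ < r := lt_of_lt_of_le hx (min_le_left _ _)
  have hx2 : dist x x₀ < s / 2 := lt_of_lt_of_le hx (min_le_right _ _)
  have hv1 : ‖v‖ < r := lt_of_lt_of_le hv (min_le_left _ _)
  have hv2 : ‖v‖ < s / 2 := lt_of_lt_of_le hv (min_le_right _ _)
  have e1 : f (x + v) = g (x + v) := hfg _ (by
    have := dist_triangle (x + v) x x₀
    rw [dist_self_add_left] at this
    rw [Metric.mem_ball]; linarith)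
  have e2 : f (x - v) = g (x - v) := hfg _ (by
    have := dist_triangle (x - v) x x₀
    rw [dist_eq_norm (x - v) x, sub_sub_cancel_left, norm_neg] at this
    rw [Metric.mem_ball]; linarith)
  have e3 : f x = g x := hfg _ (by rw [Metric.mem_ball]; linarith)
  rw [← e1, ← e2, ← e3]
  exact H x hx1 v hv1

variable {E : Type*} [NormedAddCommGroup E] [InnerProductSpace ℝ E]

/-- A second difference bound turns a subgradient into a quadratic upper bound. -/
theorem le_of_secondDiff_le {f : E → ℝ} {x p v : E} {Λ : ℝ}
    (hp : f x + ⟪p, -v⟫ ≤ f (x - v)) (h : f (x + v) + f (x - v) - 2 * f x ≤ Λ * ‖v‖ ^ 2) :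
    f (x + v) ≤ f x + ⟪p, v⟫ + Λ * ‖v‖ ^ 2 := by
  rw [inner_neg_right] at hp; linarith

theorem norm_subgradient_sub_le {f : E → ℝ} {p : E → E} {x y : E} {Λ : ℝ} (hΛ : 0 ≤ Λ)
    (hx : ∀ w, ‖w‖ ≤ ‖x - y‖ → f x + ⟪p x, y + w - x⟫ ≤ f (y + w))
    (hxy : f y ≤ f x + ⟪p x, y - x⟫ + Λ * ‖y - x‖ ^ 2)
    (hy : ∀ w, ‖w‖ ≤ ‖x - y‖ → f (y + w) ≤ f y + ⟪p y, w⟫ + Λ * ‖w‖ ^ 2) :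
    ‖p x - p y‖ ≤ 2 * Λ * ‖x - y‖ := by
  rcases eq_or_ne x y with rfl | hne
  · simp
  have hpos : 0 < ‖x - y‖ := norm_pos_iff.2 (sub_ne_zero.2 hne)
  refine norm_le_of_inner_le_of_norm_eq hpos (by positivity) fun w hw => ?_
  have h1 := hx w hw.le
  have h2 := hy w hw.le
  rw [add_sub_right_comm, inner_add_right] at h1
  rw [hw] at h2
  rw [norm_sub_rev y x] at hxy
  rw [inner_sub_left]
  nlinarith

variable {n : ℕ}

/-- A convex function with locally bounded second differences has a locally Lipschitz derivative. -/
theorem isC11LocOn_of_hasSecondDiffBoundAt {U : Set (EuclideanSpace ℝ (Fin n))}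
    {f : EuclideanSpace ℝ (Fin n) → ℝ} (hU : IsOpen U) (hf : ConvexOn ℝ U f)
    (h : ∀ x ∈ U, HasSecondDiffBoundAt f x) : IsC11LocOn U f := by
  have hsub : ∀ x, ∃ p : EuclideanSpace ℝ (Fin n), x ∈ U → ∀ y ∈ U, f x + ⟪p, y - x⟫ ≤ f y := by
    intro x
    by_cases hx : x ∈ U
    · obtain ⟨p, hp⟩ := hf.exists_subgradient hU hx
      exact ⟨p, fun _ => hp⟩
    · exact ⟨0, fun h => absurd h hx⟩
  choose p hp using hsub
  have key : ∀ x₀ ∈ U, ∃ Λ r : ℝ, 0 ≤ Λ ∧ 0 < r ∧ ∀ x ∈ Metric.ball x₀ r, x ∈ U ∧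
      ∀ v, ‖v‖ < r → x + v ∈ U ∧ f (x + v) ≤ f x + ⟪p x, v⟫ + Λ * ‖v‖ ^ 2 := by
    intro x₀ hx₀
    obtain ⟨Λ, r, hΛ, hr, H⟩ := h x₀ hx₀
    obtain ⟨s, hs, hsU⟩ := Metric.isOpen_iff.1 hU x₀ hx₀
    have hmem : ∀ x ∈ Metric.ball x₀ (s / 2), ∀ v, ‖v‖ < s / 2 → x + v ∈ U := by
      intro x hx v hv
      apply hsU
      have := dist_triangle (x + v) x x₀
      rw [dist_self_add_left] at this
      rw [Metric.mem_ball] at hx ⊢; linarith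
    refine ⟨Λ, min r (s / 2), hΛ, by positivity, fun x hx => ?_⟩
    have hx1 : x ∈ Metric.ball x₀ r := Metric.ball_subset_ball (min_le_left _ _) hx
    have hx2 : x ∈ Metric.ball x₀ (s / 2) := Metric.ball_subset_ball (min_le_right _ _) hx
    have hxU : x ∈ U := by simpa using hmem x hx2 0 (by simpa using hs)
    refine ⟨hxU, fun v hv => ?_⟩
    have hv1 : ‖v‖ < r := lt_of_lt_of_le hv (min_le_left _ _)
    have hv2 : ‖v‖ < s / 2 := lt_of_lt_of_le hv (min_le_right _ _)
    refine ⟨hmem x hx2 v hv2, le_of_secondDiff_le ?_ (H x hx1 v hv1)⟩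
    have hm := hmem x hx2 (-v) (by rwa [norm_neg])
    have := hp x hxU _ hm
    rwa [add_sub_cancel_left, ← sub_eq_add_neg] at this
  refine ⟨fun x => innerSL ℝ (p x), fun x hx => ?_, fun x₀ hx₀ => ?_⟩
  · obtain ⟨Λ, r, hΛ, hr, H⟩ := key x hx
    obtain ⟨-, H⟩ := H x (Metric.mem_ball_self hr)
    rw [hasFDerivAt_iff_isLittleO_nhds_zero]
    refine Asymptotics.IsBigO.trans_isLittleO (g := fun v : EuclideanSpace ℝ (Fin n) => ‖v‖ ^ 2)
      (Asymptotics.IsBigO.of_bound Λ ?_) ?_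
    · filter_upwards [Metric.ball_mem_nhds (0 : EuclideanSpace ℝ (Fin n)) hr] with v hv
      rw [mem_ball_zero_iff] at hv
      obtain ⟨hvU, hv1⟩ := H v hv
      have hv2 := hp x hx _ hvU
      rw [add_sub_cancel_left] at hv2
      rw [innerSL_apply_apply, Real.norm_of_nonneg (by linarith), norm_pow, norm_norm]
      linarith
    · exact Asymptotics.isLittleO_norm_pow_id one_lt_two
  · obtain ⟨Λ, r, hΛ, hr, H⟩ := key x₀ hx₀
    refine ⟨(2 * Λ).toNNReal, r / 4, by positivity, ?_⟩
    refine LipschitzOnWith.mono ?_ inter_subset_left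
    refine LipschitzOnWith.of_dist_le_mul fun x hx y hy => ?_
    have hxy : ‖x - y‖ < r / 2 := by
      rw [← dist_eq_norm]
      have := dist_triangle_right x y x₀
      rw [Metric.mem_ball] at hx hy; linarith
    have hx' := H x (Metric.ball_subset_ball (by linarith) hx)
    have hy' := H y (Metric.ball_subset_ball (by linarith) hy)
    rw [dist_eq_norm, ← map_sub, innerSL_apply_norm, dist_eq_norm,
      Real.coe_toNNReal _ (by positivity)]
    refine norm_subgradient_sub_le (f := f) hΛ (fun w hw => ?_) ?_ (fun w hw => ?_)
    · exact hp x hx'.1 _ (hy'.2 w (by linarith)).1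
    · have := (hx'.2 (y - x) (by rw [norm_sub_rev]; linarith)).2
      rwa [add_sub_cancel] at this
    · exact (hy'.2 w (by linarith)).2

end SecondDifference

section SecondOrder

variable {E : Type*} [NormedAddCommGroup E] [InnerProductSpace ℝ E]

/-- A local quadratic upper bound for a Lipschitz function at a point with a subgradient is
global, after enlarging the constant. -/
theorem quadratic_bound_of_local {φ : E → ℝ} {L : NNReal} (hL : LipschitzWith L φ) {x p : E}
    (hp : ∀ y, φ x + ⟪p, y - x⟫ ≤ φ y) {Λ r : ℝ} (hΛ : 0 ≤ Λ) (hr : 0 < r)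
    (h : ∀ u, ‖u‖ < r → φ (x + u) ≤ φ x + ⟪p, u⟫ + Λ * ‖u‖ ^ 2) (u : E) :
    φ (x + u) ≤ φ x + ⟪p, u⟫ + (Λ + 2 * L / r) * ‖u‖ ^ 2 := by
  have hLr : 0 ≤ 2 * L / r := by positivity
  rcases lt_or_ge ‖u‖ r with hu | hu
  · nlinarith [h u hu, mul_nonneg hLr (sq_nonneg ‖u‖)]
  · have h1 : φ (x + u) - φ x ≤ L * ‖u‖ := by
      have := hL.dist_le_mul (x + u) x
      rw [dist_self_add_left, Real.dist_eq] at this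
      exact (le_abs_self _).trans this
    have h2 : -⟪p, u⟫ ≤ L * ‖u‖ := by
      have h3 := hp (x - u)
      have := hL.dist_le_mul (x - u) x
      rw [dist_eq_norm (x - u) x, sub_sub_cancel_left, norm_neg, Real.dist_eq] at this
      rw [sub_sub_cancel_left, inner_neg_right] at h3
      linarith [(le_abs_self _).trans this]
    have h4 : 2 * L * ‖u‖ ≤ 2 * L / r * ‖u‖ ^ 2 := by
      have : 2 * L / r * r ≤ 2 * L / r * ‖u‖ := mul_le_mul_of_nonneg_left hu hLr
      rw [div_mul_cancel₀ _ hr.ne'] at this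
      nlinarith [norm_nonneg u]
    nlinarith [mul_nonneg hΛ (sq_nonneg ‖u‖)]

/-- Subgradients converge at points of differentiability. -/
theorem tendsto_subgradient [CompleteSpace E] {φ : E → ℝ} {p : E → E}
    (hp : ∀ x y, φ x + ⟪p x, y - x⟫ ≤ φ y)
    {x : E} (hd : DifferentiableAt ℝ φ x) : Tendsto p (𝓝 x) (𝓝 (p x)) := by
  have hder : HasFDerivAt φ (innerSL ℝ (p x)) x := by
    have h1 : HasFDerivAt (fun y => φ y - innerSL ℝ (p x) y)
        (fderiv ℝ φ x - innerSL ℝ (p x)) x :=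
      hd.hasFDerivAt.sub (innerSL ℝ (p x)).hasFDerivAt
    have h2 : IsLocalMin (fun y => φ y - innerSL ℝ (p x) y) x := by
      refine Eventually.of_forall fun y => ?_
      have := hp x y
      simp only [innerSL_apply_apply, inner_sub_right] at this ⊢
      linarith
    rw [← sub_eq_zero.1 (h2.hasFDerivAt_eq_zero h1)]
    exact hd.hasFDerivAt
  rw [Metric.tendsto_nhds_nhds]
  intro ε hε
  obtain ⟨r, hr, hball⟩ := Metric.eventually_nhds_iff_ball.1
    (hder.isLittleO.def (c := ε / 4) (by positivity))
  refine ⟨r / 3, by positivity, fun y hy => ?_⟩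
  rw [dist_eq_norm] at hy
  suffices h : ‖p y - p x‖ ≤ ε / 2 by rw [dist_eq_norm]; linarith
  refine norm_le_of_inner_le_of_norm_eq (δ := r / 3) (by positivity) (by positivity)
    fun w hw => ?_
  have hyw : ‖y + w - x‖ ≤ 2 * (r / 3) := by
    have := norm_add_le (y - x) w
    rw [add_sub_right_comm]; linarith
  have h1 := hball (y + w) (by rw [mem_ball_iff_norm]; linarith)
  rw [Real.norm_eq_abs, innerSL_apply_apply] at h1
  have h2 := (le_abs_self _).trans h1
  have h3 := hp x y
  have h4 := hp y (y + w)
  rw [add_sub_cancel_left] at h4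
  have h5 : ⟪p x, y + w - x⟫ = ⟪p x, y - x⟫ + ⟪p x, w⟫ := by
    rw [add_sub_right_comm, inner_add_right]
  rw [inner_sub_left]
  nlinarith

variable {n : ℕ}

theorem LipschitzOnWith.volume_image_eq_zero
    {P : EuclideanSpace ℝ (Fin n) → EuclideanSpace ℝ (Fin n)} {K : NNReal}
    {s : Set (EuclideanSpace ℝ (Fin n))} (hP : LipschitzOnWith K P s) (hs : volume s = 0) :
    volume (P '' s) = 0 := by
  have hac := Measure.absolutelyContinuous_isAddHaarMeasure
    (volume : Measure (EuclideanSpace ℝ (Fin n))) (Measure.hausdorffMeasure (n : ℝ))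
  have hca := Measure.absolutelyContinuous_isAddHaarMeasure
    (Measure.hausdorffMeasure (n : ℝ)) (volume : Measure (EuclideanSpace ℝ (Fin n)))
  refine hac (le_antisymm ?_ bot_le)
  calc _ ≤ _ := hP.hausdorffMeasure_image_le (Nat.cast_nonneg n)
    _ = 0 := by rw [hca hs, mul_zero]

/-- A Lipschitz convex function has a quadratic upper bound at almost every point. -/
theorem ae_exists_quadratic_bound {φ : EuclideanSpace ℝ (Fin n) → ℝ} {L : NNReal}
    (hL : LipschitzWith L φ) (hφ : ConvexOn ℝ univ φ) :
    ∀ᵐ x, ∃ (p : EuclideanSpace ℝ (Fin n)) (Λ : ℝ), 0 ≤ Λ ∧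
      ∀ u, φ (x + u) ≤ φ x + ⟪p, u⟫ + Λ * ‖u‖ ^ 2 := by
  choose p hp using fun x => hφ.exists_subgradient isOpen_univ (mem_univ x)
  replace hp : ∀ x y, φ x + ⟪p x, y - x⟫ ≤ φ y := fun x y => hp x y (mem_univ y)
  set T : EuclideanSpace ℝ (Fin n) → EuclideanSpace ℝ (Fin n) := fun y => y + p y with hT
  have hexp : ∀ x y, ‖x - y‖ ≤ ‖T x - T y‖ := by
    intro x y
    have h1 := hp x y
    have h2 := hp y x
    have h3 : ⟪T x - T y, x - y⟫ = ‖x - y‖ ^ 2 + ⟪p x - p y, x - y⟫ := by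
      rw [← real_inner_self_eq_norm_sq, ← inner_add_left]; congr 1; simp only [hT]; abel
    have h4 : 0 ≤ ⟪p x - p y, x - y⟫ := by
      rw [← neg_sub x y, inner_neg_right] at h1
      rw [inner_sub_left]; linarith
    have h5 := real_inner_le_norm (T x - T y) (x - y)
    by_contra! hlt
    nlinarith [norm_nonneg (T x - T y)]
  have hinj : Function.Injective T := by
    intro x y hxy
    have := hexp x y
    rw [hxy, sub_self, norm_zero] at this
    exact sub_eq_zero.1 (norm_le_zero_iff.1 this)
  set P := Function.invFun T
  have hPT : ∀ x, P (T x) = x := Function.leftInverse_invFun hinj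
  have hP : LipschitzOnWith 1 P (range T) := by
    refine LipschitzOnWith.of_dist_le_mul ?_
    rintro _ ⟨x, rfl⟩ _ ⟨y, rfl⟩
    rw [hPT, hPT, dist_eq_norm, dist_eq_norm, NNReal.coe_one, one_mul]
    exact hexp x y
  have hN : volume (P '' {z | z ∈ range T ∧ ¬ DifferentiableWithinAt ℝ P (range T) z}) = 0 := by
    refine (hP.mono fun z hz => hz.1).volume_image_eq_zero ?_
    have := hP.ae_differentiableWithinAt_of_mem (μ := volume)
    rw [ae_iff] at this
    simpa only [Classical.not_imp] using this
  have hZ : volume (P '' {z | DifferentiableWithinAt ℝ P (range T) z ∧ z ∈ range T ∧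
      (fderivWithin ℝ P (range T) z).det = 0}) = 0 :=
    addHaar_image_eq_zero_of_det_fderivWithin_eq_zero _
      (fun z hz => hz.1.hasFDerivWithinAt.mono fun z hz => hz.2.1) fun z hz => hz.2.2
  filter_upwards [hL.ae_differentiableAt, compl_mem_ae_iff.2 hN, compl_mem_ae_iff.2 hZ]
    with x hdx hxN hxZ
  have hdiff : DifferentiableWithinAt ℝ P (range T) (T x) := by
    by_contra hcon
    exact hxN ⟨T x, ⟨mem_range_self x, hcon⟩, hPT x⟩
  have hdet : (fderivWithin ℝ P (range T) (T x)).det ≠ 0 := fun hcon =>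
    hxZ ⟨T x, ⟨hdiff, mem_range_self x, hcon⟩, hPT x⟩
  obtain ⟨c, hc, hA⟩ : ∃ c : ℝ, 0 < c ∧
      ∀ v, c * ‖v‖ ≤ ‖fderivWithin ℝ P (range T) (T x) v‖ := by
    set B := (fderivWithin ℝ P (range T) (T x)).toContinuousLinearEquivOfDetNeZero hdet
    refine ⟨(‖(B.symm : EuclideanSpace ℝ (Fin n) →L[ℝ] EuclideanSpace ℝ (Fin n))‖ + 1)⁻¹,
      by positivity, fun v => ?_⟩
    rw [inv_mul_le_iff₀ (by positivity)]
    have h1 := (B.symm : EuclideanSpace ℝ (Fin n) →L[ℝ] EuclideanSpace ℝ (Fin n)).le_opNorm (B v)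
    have h2 : B v = fderivWithin ℝ P (range T) (T x) v := rfl
    simp only [ContinuousLinearEquiv.coe_coe, ContinuousLinearEquiv.symm_apply_apply] at h1
    rw [h2] at h1
    nlinarith [norm_nonneg (fderivWithin ℝ P (range T) (T x) v)]
  have htend : Tendsto T (𝓝 x) (𝓝[range T] (T x)) :=
    tendsto_nhdsWithin_iff.2 ⟨tendsto_id.add (tendsto_subgradient hp hdx),
      Eventually.of_forall fun y => mem_range_self y⟩
  obtain ⟨r, hr, hball⟩ := Metric.eventually_nhds_iff_ball.1
    (htend.eventually (hdiff.hasFDerivWithinAt.isLittleO.def (half_pos hc)))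
  refine ⟨p x, 2 / c + 1 + 2 * L / r, by positivity,
    quadratic_bound_of_local hL (hp x) (by positivity) hr fun u hu => ?_⟩
  have h1 := hball (x + u) (by rwa [mem_ball_iff_norm, add_sub_cancel_left])
  rw [hPT, hPT, add_sub_cancel_left] at h1
  have h2 := hA (T (x + u) - T x)
  have h3 := norm_sub_norm_le (fderivWithin ℝ P (range T) (T x) (T (x + u) - T x)) u
  rw [norm_sub_rev] at h3
  have h4 : ‖T (x + u) - T x‖ ≤ 2 / c * ‖u‖ := by
    rw [div_mul_eq_mul_div, le_div_iff₀ hc]; nlinarith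
  have h5 : ‖p (x + u) - p x‖ ≤ (2 / c + 1) * ‖u‖ := by
    have : p (x + u) - p x = (T (x + u) - T x) - u := by simp only [hT]; abel
    rw [this]
    have := norm_sub_le (T (x + u) - T x) u
    linarith
  have h6 := hp (x + u) x
  rw [sub_add_cancel_left, inner_neg_right] at h6
  have h7 := real_inner_le_norm (p (x + u) - p x) u
  rw [inner_sub_left] at h7
  nlinarith [norm_nonneg u]

end SecondOrder

section Envelope

variable {E : Type*} [NormedAddCommGroup E] [InnerProductSpace ℝ E]

/-- The heights at `x` of the paraboloids `c + ρ • w ↦ α + ρ ‖w‖² / 2` lying above `φ` whose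
opening `ρ` is at least `θ (C - α)`. The degenerate opening `ρ = 0` is allowed. -/
def paraboloidHeights (φ : E → ℝ) (θ C : ℝ) (x : E) : Set ℝ :=
  {s | ∃ (c z : E) (ρ α : ℝ), 0 ≤ ρ ∧ θ * (C - α) ≤ ρ ∧
    (∀ w, φ (c + ρ • w) ≤ α + ρ * ‖w‖ ^ 2 / 2) ∧ c + ρ • z = x ∧ α + ρ * ‖z‖ ^ 2 / 2 ≤ s}

/-- The lower envelope of the paraboloids above `φ` with opening at least `θ (C - α)`, where `α`
is the minimum of the paraboloid. -/
noncomputable def paraboloidEnvelope (φ : E → ℝ) (θ C : ℝ) (x : E) : ℝ :=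
  sInf (paraboloidHeights φ θ C x)

variable {φ : E → ℝ} {θ C : ℝ} {L : NNReal} {x : E}

theorem le_of_mem_paraboloidHeights {s : ℝ} (hs : s ∈ paraboloidHeights φ θ C x) : φ x ≤ s := by
  obtain ⟨c, z, ρ, α, -, -, h, rfl, hs⟩ := hs
  exact (h z).trans hs

theorem bddBelow_paraboloidHeights : BddBelow (paraboloidHeights φ θ C x) :=
  ⟨φ x, fun _ => le_of_mem_paraboloidHeights⟩

theorem paraboloidEnvelope_le {s : ℝ} (hs : s ∈ paraboloidHeights φ θ C x) :
    paraboloidEnvelope φ θ C x ≤ s :=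
  csInf_le bddBelow_paraboloidHeights hs

theorem mem_paraboloidHeights_of_ge (h : C ≤ φ x) (hθ : 0 ≤ θ) :
    φ x ∈ paraboloidHeights φ θ C x :=
  ⟨x, 0, 0, φ x, le_rfl, mul_nonpos_of_nonneg_of_nonpos hθ (by linarith), by simp, by simp,
    by simp⟩

theorem mem_paraboloidHeights_of_le (hL : LipschitzWith L φ) (h : φ x ≤ C) (hθ : 0 ≤ θ) :
    φ x + θ * (C - φ x) * L ^ 2 / 2 ∈ paraboloidHeights φ θ C x := by
  have hρ : 0 ≤ θ * (C - φ x) := mul_nonneg hθ (by linarith)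
  refine ⟨x, 0, θ * (C - φ x), φ x + θ * (C - φ x) * L ^ 2 / 2, hρ, ?_, fun w => ?_, by simp,
    by simp⟩
  · exact mul_le_mul_of_nonneg_left (by nlinarith [mul_nonneg hρ (sq_nonneg (L : ℝ))]) hθ
  · have := hL.dist_le_mul (x + (θ * (C - φ x)) • w) x
    rw [dist_self_add_left, norm_smul, Real.norm_of_nonneg hρ, Real.dist_eq] at this
    have := (le_abs_self _).trans this
    nlinarith [mul_nonneg hρ (sq_nonneg ((L : ℝ) - ‖w‖))]

theorem nonempty_paraboloidHeights (hL : LipschitzWith L φ) (hθ : 0 ≤ θ) :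
    (paraboloidHeights φ θ C x).Nonempty := by
  rcases le_total (φ x) C with h | h
  · exact ⟨_, mem_paraboloidHeights_of_le hL h hθ⟩
  · exact ⟨_, mem_paraboloidHeights_of_ge h hθ⟩

theorem le_paraboloidEnvelope (hL : LipschitzWith L φ) (hθ : 0 ≤ θ) :
    φ x ≤ paraboloidEnvelope φ θ C x :=
  le_csInf (nonempty_paraboloidHeights hL hθ) fun _ => le_of_mem_paraboloidHeights

theorem paraboloidEnvelope_lt (hL : LipschitzWith L φ) (hθ : 0 ≤ θ) (hθL : θ * L ^ 2 < 2)
    (h : φ x < C) : paraboloidEnvelope φ θ C x < C := by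
  refine (paraboloidEnvelope_le (mem_paraboloidHeights_of_le hL h.le hθ)).trans_lt ?_
  nlinarith

theorem paraboloidEnvelope_eq_of_ge (hL : LipschitzWith L φ) (hθ : 0 ≤ θ) (h : C ≤ φ x) :
    paraboloidEnvelope φ θ C x = φ x :=
  le_antisymm (paraboloidEnvelope_le (mem_paraboloidHeights_of_ge h hθ))
    (le_paraboloidEnvelope hL hθ)

theorem paraboloidEnvelope_eq_of_quadratic_bound (hL : LipschitzWith L φ) (hθ : 0 ≤ θ)
    {p : E} {ρ : ℝ} (hρ : 0 < ρ)
    (h : ∀ u, φ (x + u) ≤ φ x + ⟪p, u⟫ + ‖u‖ ^ 2 / (2 * ρ))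
    (hθρ : θ * (C - φ x + ρ * ‖p‖ ^ 2 / 2) ≤ ρ) : paraboloidEnvelope φ θ C x = φ x := by
  refine le_antisymm (paraboloidEnvelope_le ?_) (le_paraboloidEnvelope hL hθ)
  refine ⟨x - ρ • p, p, ρ, φ x - ρ * ‖p‖ ^ 2 / 2, hρ.le, by convert hθρ using 2; ring,
    fun w => ?_, by simp, by simp⟩
  have h1 := h (ρ • (w - p))
  have e1 : x + ρ • (w - p) = x - ρ • p + ρ • w := by rw [smul_sub]; abel
  have e2 : ‖ρ • (w - p)‖ ^ 2 / (2 * ρ) = ρ * ‖w - p‖ ^ 2 / 2 := by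
    rw [norm_smul, Real.norm_of_nonneg hρ.le]; field_simp
  rw [e1, e2, real_inner_smul_right, inner_sub_right, real_inner_self_eq_norm_sq,
    norm_sub_sq_real, real_inner_comm] at h1
  rw [real_inner_comm] at h1
  linarith

theorem paraboloidHeights_anti {θ' : ℝ} (h : θ ≤ θ') (hθ : 0 ≤ θ) :
    paraboloidHeights φ θ' C x ⊆ paraboloidHeights φ θ C x := by
  rintro s ⟨c, z, ρ, α, hρ, hρα, H⟩
  refine ⟨c, z, ρ, α, hρ, ?_, H⟩
  rcases le_total 0 (C - α) with h0 | h0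
  · exact (mul_le_mul_of_nonneg_right h h0).trans hρα
  · exact (mul_nonpos_of_nonneg_of_nonpos hθ h0).trans hρ

theorem paraboloidEnvelope_mono (hL : LipschitzWith L φ) {θ' : ℝ} (h : θ ≤ θ') (hθ : 0 ≤ θ) :
    paraboloidEnvelope φ θ C x ≤ paraboloidEnvelope φ θ' C x :=
  csInf_le_csInf bddBelow_paraboloidHeights (nonempty_paraboloidHeights hL (hθ.trans h))
    (paraboloidHeights_anti h hθ)

theorem paraboloidHeights_combo (hφ : ConvexOn ℝ univ φ) {y : E} {s t a b : ℝ} (ha : 0 ≤ a)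
    (hb : 0 ≤ b) (hab : a + b = 1) (hs : s ∈ paraboloidHeights φ θ C x)
    (ht : t ∈ paraboloidHeights φ θ C y) :
    a * s + b * t ∈ paraboloidHeights φ θ C (a • x + b • y) := by
  obtain ⟨c, z, ρ, α, hρ, hρα, h, rfl, hs⟩ := hs
  obtain ⟨c', z', ρ', α', hρ', hρα', h', rfl, ht⟩ := ht
  have hm : 0 ≤ a * ρ := mul_nonneg ha hρ
  have hm' : 0 ≤ b * ρ' := mul_nonneg hb hρ'
  have hs' := mul_le_mul_of_nonneg_left hs ha
  have ht' := mul_le_mul_of_nonneg_left ht hb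
  have hz : ∃ w : E, (a * ρ + b * ρ') • w = (a * ρ) • z + (b * ρ') • z' ∧
      (a * ρ + b * ρ') * ‖w‖ ^ 2 ≤ a * ρ * ‖z‖ ^ 2 + b * ρ' * ‖z'‖ ^ 2 := by
    rcases eq_or_lt_of_le (add_nonneg hm hm') with h0 | h0
    · have h1 : a * ρ = 0 := by linarith
      have h2 : b * ρ' = 0 := by linarith
      exact ⟨0, by simp [h1, h2], by simp [h1, h2]⟩
    · refine ⟨(a * ρ + b * ρ')⁻¹ • ((a * ρ) • z + (b * ρ') • z'), by
        rw [smul_inv_smul₀ h0.ne'], ?_⟩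
      rw [norm_smul, norm_inv, Real.norm_of_nonneg h0.le, mul_pow, inv_pow, ← mul_assoc, pow_two,
        mul_inv, mul_inv_cancel_left₀ h0.ne', inv_mul_le_iff₀ h0]
      have h1 : ‖(a * ρ) • z + (b * ρ') • z'‖ ≤ a * ρ * ‖z‖ + b * ρ' * ‖z'‖ := by
        refine (norm_add_le _ _).trans ?_
        rw [norm_smul, norm_smul, Real.norm_of_nonneg hm, Real.norm_of_nonneg hm']
      have h2 := pow_le_pow_left₀ (norm_nonneg _) h1 2
      nlinarith [mul_nonneg (mul_nonneg hm hm') (sq_nonneg (‖z‖ - ‖z'‖))]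
  obtain ⟨w, hw, hw'⟩ := hz
  refine ⟨a • c + b • c', w, a * ρ + b * ρ', a * α + b * α', add_nonneg hm hm', ?_,
    fun v => ?_, ?_, ?_⟩
  · have e : θ * (C - (a * α + b * α')) = a * (θ * (C - α)) + b * (θ * (C - α')) := by
      have : C = (a + b) * C := by rw [hab, one_mul]
      linear_combination θ * this
    rw [e]
    exact add_le_add (mul_le_mul_of_nonneg_left hρα ha) (mul_le_mul_of_nonneg_left hρα' hb)
  · have h1 := hφ.2 (mem_univ (c + ρ • v)) (mem_univ (c' + ρ' • v)) ha hb hab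
    have e : a • (c + ρ • v) + b • (c' + ρ' • v) =
        a • c + b • c' + (a * ρ + b * ρ') • v := by module
    rw [e, smul_eq_mul, smul_eq_mul] at h1
    have h2 := mul_le_mul_of_nonneg_left (h v) ha
    have h3 := mul_le_mul_of_nonneg_left (h' v) hb
    linarith
  · rw [hw]; module
  · linarith

theorem convexOn_paraboloidEnvelope (hφ : ConvexOn ℝ univ φ) (hL : LipschitzWith L φ)
    (hθ : 0 ≤ θ) : ConvexOn ℝ univ (paraboloidEnvelope φ θ C) := by
  refine ⟨convex_univ, fun x _ y _ a b ha hb hab => ?_⟩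
  refine le_of_forall_pos_le_add fun ε hε => ?_
  obtain ⟨s, hs, hsε⟩ := exists_lt_of_csInf_lt (nonempty_paraboloidHeights hL hθ)
    (lt_add_of_pos_right (paraboloidEnvelope φ θ C x) hε)
  obtain ⟨t, ht, htε⟩ := exists_lt_of_csInf_lt (nonempty_paraboloidHeights hL hθ)
    (lt_add_of_pos_right (paraboloidEnvelope φ θ C y) hε)
  have h1 := paraboloidEnvelope_le (paraboloidHeights_combo hφ ha hb hab hs ht)
  have h2 := mul_le_mul_of_nonneg_left hsε.le ha
  have h3 := mul_le_mul_of_nonneg_left htε.le hb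
  have h4 : a * ε + b * ε = ε := by rw [← add_mul, hab, one_mul]
  simp only [smul_eq_mul]
  linarith

variable [FiniteDimensional ℝ E]

theorem continuous_paraboloidEnvelope (hφ : ConvexOn ℝ univ φ) (hL : LipschitzWith L φ)
    (hθ : 0 ≤ θ) : Continuous (paraboloidEnvelope φ θ C) :=
  continuousOn_univ.1 ((convexOn_paraboloidEnvelope hφ hL hθ).continuousOn isOpen_univ)

theorem hasSecondDiffBoundAt_paraboloidEnvelope (hφ : ConvexOn ℝ univ φ)
    (hL : LipschitzWith L φ) (hθ : 0 < θ) (hx : paraboloidEnvelope φ θ C x < C) :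
    HasSecondDiffBoundAt (paraboloidEnvelope φ θ C) x := by
  obtain ⟨η, hη, hxη⟩ : ∃ η > 0, paraboloidEnvelope φ θ C x < C - 2 * η :=
    ⟨(C - paraboloidEnvelope φ θ C x) / 3, by linarith, by linarith⟩
  obtain ⟨r, hr, hball⟩ := Metric.eventually_nhds_iff_ball.1
    ((continuous_paraboloidEnvelope (C := C) hφ hL hθ.le).continuousAt.eventually_lt_const hxη)
  have hθη : 0 < θ * η := mul_pos hθ hη
  refine ⟨1 / (θ * η), r, by positivity, hr, fun y hy v _ => ?_⟩
  refine le_of_forall_pos_le_add fun ε hε => ?_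
  obtain ⟨s, ⟨c, z, ρ, α, hρ, hρα, h, hcz, hs⟩, hsε⟩ :=
    exists_lt_of_csInf_lt (nonempty_paraboloidHeights hL hθ.le)
    (lt_add_of_pos_right (paraboloidEnvelope φ θ C y) (lt_min hη (half_pos hε)))
  change s < paraboloidEnvelope φ θ C y + _ at hsε
  have hs1 : s < paraboloidEnvelope φ θ C y + η :=
    hsε.trans_le (add_le_add_right (min_le_left _ _) _)
  have hs2 : s < paraboloidEnvelope φ θ C y + ε / 2 :=
    hsε.trans_le (add_le_add_right (min_le_right _ _) _)
  have hα : α ≤ s := by nlinarith [mul_nonneg hρ (sq_nonneg ‖z‖)]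
  have hρη : θ * η ≤ ρ := by
    refine le_trans (mul_le_mul_of_nonneg_left ?_ hθ.le) hρα
    linarith [hball y hy]
  have hρ0 : 0 < ρ := hθη.trans_le hρη
  have hup : ∀ u : E, paraboloidEnvelope φ θ C (y + u) ≤ s + ⟪z, u⟫ + ‖u‖ ^ 2 / (2 * ρ) := by
    intro u
    refine paraboloidEnvelope_le ⟨c, z + ρ⁻¹ • u, ρ, α, hρ, hρα, h, ?_, ?_⟩
    · rw [smul_add, smul_inv_smul₀ hρ0.ne', ← add_assoc, hcz]
    · rw [norm_add_sq_real, real_inner_smul_right, norm_smul, norm_inv, Real.norm_of_nonneg hρ]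
      have : ρ * (‖z‖ ^ 2 + 2 * (ρ⁻¹ * ⟪z, u⟫) + (ρ⁻¹ * ‖u‖) ^ 2) / 2 =
          ρ * ‖z‖ ^ 2 / 2 + ⟪z, u⟫ + ‖u‖ ^ 2 / (2 * ρ) := by field_simp
      rw [this]; linarith
  have h1 := hup v
  have h2 := hup (-v)
  rw [← sub_eq_add_neg, norm_neg, inner_neg_right] at h2
  have h3 : ‖v‖ ^ 2 / (2 * ρ) ≤ 1 / (θ * η) * ‖v‖ ^ 2 / 2 := by
    rw [div_le_iff₀ (by positivity)]
    have : 1 ≤ 1 / (θ * η) * ρ := by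
      rw [div_mul_eq_mul_div, one_mul, one_le_div hθη]; exact hρη
    nlinarith [sq_nonneg ‖v‖]
  linarith

end Envelope

section LipschitzRegularization

variable {E : Type*} [NormedAddCommGroup E] [NormedSpace ℝ E]

theorem ConvexOn.le_add_mul_norm_sub_of_lipschitzOnWith {U V : Set E} {F : E → ℝ} {L : NNReal}
    {x y : E} (hF : ConvexOn ℝ U F) (hV : V ∈ 𝓝 x) (hL : LipschitzOnWith L F V) (hx : x ∈ U)
    (hy : y ∈ U) : F x ≤ F y + L * ‖x - y‖ := by
  have hc : Tendsto (fun t : ℝ => (1 - t) • x + t • y) (𝓝[>] 0) (𝓝 x) := by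
    have : ContinuousAt (fun t : ℝ => (1 - t) • x + t • y) 0 := by fun_prop
    have h := this.tendsto.mono_left (nhdsWithin_le_nhds (s := Ioi 0))
    simpa using h
  obtain ⟨t, ⟨htV, ht1⟩, ht0⟩ := ((hc.eventually hV).and (nhdsWithin_le_nhds
    (Iio_mem_nhds one_pos))).and self_mem_nhdsWithin |>.exists
  replace ht0 : 0 < t := ht0
  replace ht1 : t < 1 := ht1
  have h1 := hF.2 hx hy (sub_nonneg.2 ht1.le) ht0.le (sub_add_cancel _ _)
  have h2 := hL.dist_le_mul x (mem_of_mem_nhds hV) _ htV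
  have e : x - ((1 - t) • x + t • y) = t • (x - y) := by module
  rw [Real.dist_eq, dist_eq_norm, e, norm_smul, Real.norm_of_nonneg ht0.le] at h2
  have h3 := (le_abs_self _).trans h2
  simp only [smul_eq_mul] at h1
  refine le_of_mul_le_mul_left ?_ ht0
  nlinarith

theorem ConvexOn.exists_forall_le_add_mul_norm_sub [FiniteDimensional ℝ E] {U K : Set E}
    {F : E → ℝ} (hU : IsOpen U) (hF : ConvexOn ℝ U F) (hK : IsCompact K) (hKU : K ⊆ U) :
    ∃ L : NNReal, ∀ x ∈ K, ∀ y ∈ U, F x ≤ F y + L * ‖x - y‖ := by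
  refine hK.induction_on (p := fun K => ∃ L : NNReal, ∀ x ∈ K, ∀ y ∈ U,
    F x ≤ F y + L * ‖x - y‖) ⟨0, by simp⟩ (fun s t hst ⟨L, h⟩ => ⟨L, fun x hx => h x (hst hx)⟩)
    ?_ fun x hx => ?_
  · rintro s t ⟨L, h⟩ ⟨L', h'⟩
    refine ⟨max L L', fun x hx y hy => ?_⟩
    rcases hx with hx | hx
    · exact (h x hx y hy).trans (by gcongr; exact le_max_left _ _)
    · exact (h' x hx y hy).trans (by gcongr; exact le_max_right _ _)
  · obtain ⟨L, V, hV, hL⟩ := hF.locallyLipschitzOn hU (hKU hx)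
    rw [hU.nhdsWithin_eq (hKU hx)] at hV
    obtain ⟨W, hWV, hWo, hxW⟩ := mem_nhds_iff.1 hV
    refine ⟨W ∩ U, mem_nhdsWithin_of_mem_nhds
      (inter_mem (hWo.mem_nhds hxW) (hU.mem_nhds (hKU hx))), L, fun z hz y hy => ?_⟩
    exact hF.le_add_mul_norm_sub_of_lipschitzOnWith (hWo.mem_nhds hz.1) (hL.mono hWV) hz.2 hy

/-- The `L`-Lipschitz regularization of a function defined on `U`. -/
noncomputable def lipschitzRegularization (U : Set E) (F : E → ℝ) (L : NNReal) (x : E) : ℝ :=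
  ⨅ y : U, F y + L * ‖x - y‖

theorem add_norm_le_of_coercive {E : Type*} [SeminormedAddCommGroup E] {U : Set E}
    {F : E → ℝ} {L : NNReal} {a b : ℝ} (ha : 0 ≤ a)
    (haL : a ≤ L) (hF : ∀ x ∈ U, a * ‖x‖ - b ≤ F x) (x : E) (y : U) :
    a * ‖x‖ - b ≤ F y + L * ‖x - y‖ := by
  have h1 := hF y y.2
  have h2 : a * ‖x‖ ≤ a * (‖x - y‖ + ‖(y : E)‖) :=
    mul_le_mul_of_nonneg_left (by simpa using norm_add_le (x - y) (y : E)) ha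
  have h3 := mul_le_mul_of_nonneg_right haL (norm_nonneg (x - y))
  linarith

theorem exists_lipschitz_convex_minorant [FiniteDimensional ℝ E] {U K : Set E} {F : E → ℝ}
    {a b : ℝ} (hU : IsOpen U) (hne : U.Nonempty) (hF : ConvexOn ℝ U F) (ha : 0 ≤ a)
    (hab : ∀ x ∈ U, a * ‖x‖ - b ≤ F x) (hK : IsCompact K) (hKU : K ⊆ U) :
    ∃ (L : NNReal) (φ : E → ℝ), LipschitzWith L φ ∧ ConvexOn ℝ univ φ ∧ (∀ x ∈ U, φ x ≤ F x) ∧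
      (∀ x ∈ K, φ x = F x) ∧ ∀ x, a * ‖x‖ - b ≤ φ x := by
  obtain ⟨L₀, hL₀⟩ := hF.exists_forall_le_add_mul_norm_sub hU hK hKU
  obtain ⟨L, hL, haL⟩ : ∃ L : NNReal, L₀ ≤ L ∧ a ≤ L :=
    ⟨max L₀ a.toNNReal, le_max_left _ _, (Real.le_coe_toNNReal a).trans
      (NNReal.coe_le_coe.2 (le_max_right _ _))⟩
  have : Nonempty U := hne.to_subtype
  have hbdd : ∀ x : E, BddBelow (range fun y : U => F y + L * ‖x - y‖) := fun x =>
    ⟨a * ‖x‖ - b, by rintro _ ⟨y, rfl⟩; exact add_norm_le_of_coercive ha haL hab x y⟩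
  have hle : ∀ x, ∀ y : U, lipschitzRegularization U F L x ≤ F y + L * ‖x - y‖ :=
    fun x y => ciInf_le (hbdd x) y
  refine ⟨L, lipschitzRegularization U F L, LipschitzWith.of_le_add_mul _ fun x y => ?_,
    ⟨convex_univ, fun x _ y _ s t hs ht hst => ?_⟩, fun x hx => ?_, fun x hx => ?_,
    fun x => le_ciInf fun y => add_norm_le_of_coercive ha haL hab x y⟩
  · rw [← sub_le_iff_le_add]
    refine le_ciInf fun z => ?_
    have h1 := hle x z
    have h2 : (L : ℝ) * ‖x - z‖ ≤ L * (dist x y + ‖y - z‖) := by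
      gcongr; rw [dist_eq_norm]; exact norm_sub_le_norm_sub_add_norm_sub x y z
    linarith
  · refine le_of_forall_pos_le_add fun ε hε => ?_
    obtain ⟨u, hu⟩ := exists_lt_of_ciInf_lt
      (lt_add_of_pos_right (lipschitzRegularization U F L x) hε)
    obtain ⟨v, hv⟩ := exists_lt_of_ciInf_lt
      (lt_add_of_pos_right (lipschitzRegularization U F L y) hε)
    have h0 := hle (s • x + t • y) ⟨_, hF.1 u.2 v.2 hs ht hst⟩
    have h1 := hF.2 u.2 v.2 hs ht hst
    have h2 : ‖s • x + t • y - (s • (u : E) + t • (v : E))‖ ≤ s * ‖x - u‖ + t * ‖y - v‖ := by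
      have e : s • x + t • y - (s • (u : E) + t • (v : E)) = s • (x - u) + t • (y - v) := by
        module
      rw [e]
      refine (norm_add_le _ _).trans ?_
      rw [norm_smul, norm_smul, Real.norm_of_nonneg hs, Real.norm_of_nonneg ht]
    have h3 := mul_le_mul_of_nonneg_left h2 L.2
    have h4 := mul_le_mul_of_nonneg_left hu.le hs
    have h5 := mul_le_mul_of_nonneg_left hv.le ht
    have h6 : s * ε + t * ε = ε := by rw [← add_mul, hst, one_mul]
    simp only [smul_eq_mul, NNReal.val_eq_coe] at *
    linarith
  · simpa using hle x ⟨x, hx⟩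
  · refine le_antisymm (by simpa using hle x ⟨x, hKU hx⟩) (le_ciInf fun y => ?_)
    exact (hL₀ x hx y y.2).trans (by gcongr)

end LipschitzRegularization

section Step

theorem exists_uniform_secondDiff_bound {E : Type*} [NormedAddCommGroup E] {F : E → ℝ}
    {K : Set E} (hK : IsCompact K)
    (h : ∀ x ∈ K, HasSecondDiffBoundAt F x) :
    ∃ Λ r : ℝ, 0 ≤ Λ ∧ 0 < r ∧ ∀ x ∈ K, ∀ v : E, ‖v‖ < r →
      F (x + v) + F (x - v) - 2 * F x ≤ Λ * ‖v‖ ^ 2 := by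
  refine hK.induction_on (p := fun K => ∃ Λ r : ℝ, 0 ≤ Λ ∧ 0 < r ∧ ∀ x ∈ K, ∀ v : E, ‖v‖ < r →
    F (x + v) + F (x - v) - 2 * F x ≤ Λ * ‖v‖ ^ 2) ⟨0, 1, le_rfl, one_pos, by simp⟩
    (fun s t hst ⟨Λ, r, hΛ, hr, h⟩ => ⟨Λ, r, hΛ, hr, fun x hx => h x (hst hx)⟩) ?_ fun x hx => ?_
  · rintro s t ⟨Λ, r, hΛ, hr, h⟩ ⟨Λ', r', hΛ', hr', h'⟩
    refine ⟨max Λ Λ', min r r', le_max_of_le_left hΛ, lt_min hr hr', fun x hx v hv => ?_⟩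
    rcases hx with hx | hx
    · exact (h x hx v (hv.trans_le (min_le_left _ _))).trans (by gcongr; exact le_max_left _ _)
    · exact (h' x hx v (hv.trans_le (min_le_right _ _))).trans (by gcongr; exact le_max_right _ _)
  · obtain ⟨Λ, r, hΛ, hr, h⟩ := h x hx
    exact ⟨_, mem_nhdsWithin_of_mem_nhds (Metric.ball_mem_nhds x hr), Λ, r, hΛ, hr, h⟩

variable {E : Type*} [NormedAddCommGroup E] [InnerProductSpace ℝ E] [FiniteDimensional ℝ E]

/-- For small `θ` the envelope agrees with `φ` on a compact set where second differences are bounded. -/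
theorem exists_paraboloidEnvelope_eq_on_compact {U K : Set E} {F φ : E → ℝ} {L : NNReal}
    {b : ℝ} (C : ℝ) (hU : IsOpen U) (hK : IsCompact K) (hKU : K ⊆ U) (hL : LipschitzWith L φ)
    (hφ : ConvexOn ℝ univ φ) (hφF : ∀ x ∈ U, φ x ≤ F x) (hφK : ∀ x ∈ K, φ x = F x)
    (hb : ∀ x, -b ≤ φ x) (hF : ∀ x ∈ K, HasSecondDiffBoundAt F x) :
    ∃ θ₀ : ℝ, 0 < θ₀ ∧ ∀ θ, 0 ≤ θ → θ ≤ θ₀ → ∀ x ∈ K, paraboloidEnvelope φ θ C x = φ x := by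
  obtain ⟨Λ, r₁, hΛ, hr₁, hsd⟩ := exists_uniform_secondDiff_bound hK hF
  obtain ⟨r₂, hr₂, hthick⟩ := hK.exists_thickening_subset_open hU hKU
  set r := min r₁ r₂ with hr_def
  have hr : 0 < r := lt_min hr₁ hr₂
  have hLr : 0 ≤ 2 * L / r := by positivity
  obtain ⟨ρ, hρ, hρΛ⟩ : ∃ ρ : ℝ, 0 < ρ ∧ Λ + 2 * L / r + 1 = 1 / (2 * ρ) :=
    ⟨1 / (2 * (Λ + 2 * L / r + 1)), by positivity, by field_simp⟩
  have hD : 0 < |C| + |b| + ρ * (L : ℝ) ^ 2 / 2 + 1 := by positivity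
  refine ⟨ρ / (|C| + |b| + ρ * (L : ℝ) ^ 2 / 2 + 1), by positivity, fun θ hθ hθ' x hx => ?_⟩
  obtain ⟨p, hp⟩ := hφ.exists_subgradient isOpen_univ (mem_univ x)
  simp only [mem_univ, true_implies] at hp
  have hpL : ‖p‖ ≤ L := by
    refine norm_le_of_inner_le_of_norm_eq one_pos L.2 fun w hw => ?_
    have h1 := hp (x + w)
    have h2 := hL.dist_le_mul (x + w) x
    rw [dist_self_add_left, hw, Real.dist_eq] at h2
    have h3 := (le_abs_self _).trans h2
    rw [add_sub_cancel_left] at h1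
    change _ ≤ (L : ℝ) * 1
    linarith
  have hmem : ∀ u : E, ‖u‖ < r → x + u ∈ U := fun u hu => hthick <|
    Metric.mem_thickening_iff.2 ⟨x, hx, by
      rw [dist_self_add_left]; exact hu.trans_le (min_le_right _ _)⟩
  have hquad := quadratic_bound_of_local hL hp hΛ hr fun u hu => by
    have h1 : F x + ⟪p, -u⟫ ≤ F (x - u) := by
      rw [← hφK x hx]
      have := hp (x - u)
      rw [sub_sub_cancel_left] at this
      refine this.trans (hφF _ ?_)
      rw [sub_eq_add_neg]
      exact hmem _ (by rwa [norm_neg])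
    rw [hφK x hx]
    exact (hφF _ (hmem u hu)).trans
      (le_of_secondDiff_le h1 (hsd x hx u (hu.trans_le (min_le_left _ _))))
  refine paraboloidEnvelope_eq_of_quadratic_bound hL hθ hρ (p := p) (fun u => ?_) ?_
  · have : ‖u‖ ^ 2 / (2 * ρ) = (Λ + 2 * L / r + 1) * ‖u‖ ^ 2 := by rw [hρΛ]; ring
    rw [this]
    nlinarith [hquad u, sq_nonneg ‖u‖]
  · rw [le_div_iff₀ hD] at hθ'
    refine le_trans (mul_le_mul_of_nonneg_left ?_ hθ) hθ'
    have h1 := mul_le_mul_of_nonneg_left (pow_le_pow_left₀ (norm_nonneg p) hpL 2) hρ.le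
    linarith [hb x, le_abs_self C, le_abs_self b]

end Step

section Measure

variable {n : ℕ}

/-- For small `θ` the envelope differs from a coercive `φ` only on a set of small measure. -/
theorem exists_volume_paraboloidEnvelope_ne_lt {φ : EuclideanSpace ℝ (Fin n) → ℝ} {L : NNReal}
    {a b θ₀ : ℝ} (C : ℝ) (hL : LipschitzWith L φ) (hφ : ConvexOn ℝ univ φ) (ha : 0 < a)
    (hab : ∀ x, a * ‖x‖ - b ≤ φ x) (hθ₀ : 0 < θ₀) {ε : ENNReal} (hε : ε ≠ 0) :
    ∃ θ : ℝ, 0 < θ ∧ θ ≤ θ₀ ∧ volume {x | paraboloidEnvelope φ θ C x ≠ φ x} < ε := by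
  set θ : ℕ → ℝ := fun m => θ₀ / (m + 1) with hθ_def
  have hθ : ∀ m, 0 < θ m := fun m => by positivity
  have hanti : Antitone θ := fun m k hmk => by
    simp only [hθ_def]; gcongr
  have hle : ∀ m, θ m ≤ θ₀ := fun m => by simpa [hθ_def] using hanti (Nat.zero_le m)
  have hlim : Tendsto θ atTop (𝓝 0) := by
    simpa [hθ_def, div_eq_mul_inv] using
      (tendsto_one_div_add_atTop_nhds_zero_nat (𝕜 := ℝ)).const_mul θ₀
  set N : ℕ → Set (EuclideanSpace ℝ (Fin n)) := fun m => {x | paraboloidEnvelope φ (θ m) C x ≠ φ x}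
  have hopen : ∀ m, IsOpen (N m) := fun m =>
    isOpen_ne_fun (continuous_paraboloidEnvelope hφ hL (hθ m).le) hL.continuous
  have hNanti : Antitone N := fun m k hmk x hx h => hx <| le_antisymm
    ((paraboloidEnvelope_mono hL (hanti hmk) (hθ k).le).trans h.le)
    (le_paraboloidEnvelope hL (hθ k).le)
  have hfin : volume (N 0) ≠ ⊤ := by
    have : N 0 ⊆ Metric.closedBall 0 ((C + b) / a) := fun x hx => by
      rw [mem_closedBall_zero_iff, le_div_iff₀ ha]
      by_contra! h
      exact hx (paraboloidEnvelope_eq_of_ge hL (hθ 0).le (by linarith [hab x]))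
    exact ((measure_mono this).trans_lt measure_closedBall_lt_top).ne
  have hnull : volume (⋂ m, N m) = 0 := by
    refine measure_mono_null ?_ (ae_iff.1 (ae_exists_quadratic_bound hL hφ))
    rintro x hx ⟨p, Λ, hΛ, h⟩
    obtain ⟨ρ, hρ, hρΛ⟩ : ∃ ρ : ℝ, 0 < ρ ∧ Λ + 1 = 1 / (2 * ρ) :=
      ⟨1 / (2 * (Λ + 1)), by positivity, by field_simp⟩
    have hlim' := hlim.mul_const (C - φ x + ρ * ‖p‖ ^ 2 / 2)
    rw [zero_mul] at hlim'
    obtain ⟨m, hm⟩ := (hlim'.eventually_le_const hρ).exists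
    refine mem_iInter.1 hx m (paraboloidEnvelope_eq_of_quadratic_bound hL (hθ m).le hρ
      (p := p) (fun u => ?_) hm)
    have : ‖u‖ ^ 2 / (2 * ρ) = (Λ + 1) * ‖u‖ ^ 2 := by rw [hρΛ]; ring
    rw [this]
    nlinarith [h u, sq_nonneg ‖u‖]
  have htend := tendsto_measure_iInter_atTop (μ := volume)
    (fun m => (hopen m).measurableSet.nullMeasurableSet) hNanti ⟨0, hfin⟩
  rw [hnull] at htend
  obtain ⟨m, hm⟩ := (htend.eventually_lt_const (pos_iff_ne_zero.2 hε)).exists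
  exact ⟨θ m, hθ m, hle m, hm⟩

/-- One correction step: enlarge `F` on a set of small measure so that second differences become
bounded inside `K`, without changing `F` on the compact set `K'` where they already are. -/
theorem exists_convex_majorant_of_compact {U K K' : Set (EuclideanSpace ℝ (Fin n))}
    {F : EuclideanSpace ℝ (Fin n) → ℝ} {a b : ℝ} (hU : IsOpen U) (hne : U.Nonempty)
    (hF : ConvexOn ℝ U F) (ha : 0 < a) (hab : ∀ x ∈ U, a * ‖x‖ - b ≤ F x) (hK : IsCompact K)
    (hKU : K ⊆ U) (hK' : IsCompact K') (hK'K : K' ⊆ K)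
    (hsd : ∀ x ∈ K', HasSecondDiffBoundAt F x) {ε : ENNReal} (hε : ε ≠ 0) :
    ∃ G : EuclideanSpace ℝ (Fin n) → ℝ, ConvexOn ℝ U G ∧ (∀ x ∈ U, F x ≤ G x) ∧
      (∀ x ∈ interior K, HasSecondDiffBoundAt G x) ∧ (∀ x ∈ K', G x = F x) ∧
      volume {x ∈ U | G x ≠ F x} < ε := by
  obtain ⟨L, φ, hL, hφ, hφF, hφK, hφb⟩ :=
    exists_lipschitz_convex_minorant hU hne hF ha.le hab hK hKU
  obtain ⟨C, hC⟩ := (hK.image hL.continuous).bddAbove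
  obtain ⟨θ₁, hθ₁, hθK'⟩ := exists_paraboloidEnvelope_eq_on_compact (C + 1) (b := b) hU hK'
    (hK'K.trans hKU) hL hφ hφF (fun x hx => hφK x (hK'K hx))
    (fun x => by nlinarith [hφb x, norm_nonneg x]) hsd
  have hL1 : 0 < (L : ℝ) ^ 2 + 1 := by positivity
  obtain ⟨θ, hθ, hθle, hvol⟩ := exists_volume_paraboloidEnvelope_ne_lt (C + 1) hL hφ ha hφb
    (lt_min hθ₁ (one_div_pos.2 hL1)) hε
  have hθL : θ * (L : ℝ) ^ 2 < 2 := by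
    have := (le_div_iff₀ hL1).1 (hθle.trans (min_le_right _ _))
    linarith
  have hle : ∀ x, φ x ≤ paraboloidEnvelope φ θ (C + 1) x := fun x => le_paraboloidEnvelope hL hθ.le
  refine ⟨F ⊔ paraboloidEnvelope φ θ (C + 1),
    hF.sup ((convexOn_paraboloidEnvelope hφ hL hθ.le).subset (subset_univ _) hF.1),
    fun x _ => le_sup_left, fun x hx => ?_, fun x hx => ?_, ?_⟩
  · have hlt : paraboloidEnvelope φ θ (C + 1) x < C + 1 :=
      paraboloidEnvelope_lt hL hθ.le hθL
        ((hC (mem_image_of_mem φ (interior_subset hx))).trans_lt (lt_add_one C))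
    refine (hasSecondDiffBoundAt_paraboloidEnvelope hφ hL hθ hlt).congr ?_
    filter_upwards [isOpen_interior.mem_nhds hx] with y hy
    refine (sup_eq_right.2 ?_).symm
    rw [← hφK y (interior_subset hy)]
    exact hle y
  · refine sup_eq_left.2 ?_
    rw [hθK' θ hθ.le (hθle.trans (min_le_left _ _)) x hx]
    exact hφF x (hKU (hK'K hx))
  · refine (measure_mono ?_).trans_lt hvol
    rintro x ⟨hxU, hx⟩ h
    exact hx (sup_eq_left.2 (h.le.trans (hφF x hxU)))

end Measure

section Exhaustion

theorem IsOpen.exists_compact_exhaustion {X : Type*} [PseudoMetricSpace X] [ProperSpace X]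
    {U : Set X} (hU : IsOpen U) :
    ∃ J : ℕ → Set X, J 0 = ∅ ∧ (∀ k, IsCompact (J k)) ∧ (∀ k, J k ⊆ U) ∧
      (∀ k, J k ⊆ interior (J (k + 1))) ∧ ∀ x ∈ U, ∃ k, x ∈ J k := by
  have : LocallyCompactSpace U := hU.locallyCompactSpace
  have : SecondCountableTopology X := inferInstance
  let K := (CompactExhaustion.choice U).shiftr
  refine ⟨fun k => Subtype.val '' K k, image_eq_empty.2 rfl,
    fun k => (K.isCompact k).image continuous_subtype_val, fun k => by
      rintro _ ⟨x, -, rfl⟩; exact x.2, fun k => ?_, fun x hx => ?_⟩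
  · refine (image_mono (K.subset_interior_succ k)).trans ?_
    exact interior_maximal (image_mono interior_subset)
      (hU.isOpenMap_subtype_val _ isOpen_interior)
  · obtain ⟨k, hk⟩ := K.exists_mem ⟨x, hx⟩
    exact ⟨k, _, hk, rfl⟩

variable {n : ℕ}

/-- A coercive convex function has convex majorants with locally bounded second differences which
differ from it on a set of arbitrarily small measure. -/
theorem exists_C11_convex_majorant_of_coercive {U : Set (EuclideanSpace ℝ (Fin n))}
    {f : EuclideanSpace ℝ (Fin n) → ℝ} {a b : ℝ} (hU : IsOpen U) (hne : U.Nonempty)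
    (hf : ConvexOn ℝ U f) (ha : 0 < a) (hab : ∀ x ∈ U, a * ‖x‖ - b ≤ f x) {ε : ENNReal}
    (hε : ε ≠ 0) :
    ∃ g : EuclideanSpace ℝ (Fin n) → ℝ, ConvexOn ℝ U g ∧
      (∀ x ∈ U, HasSecondDiffBoundAt g x) ∧ volume {x ∈ U | f x ≠ g x} < ε ∧
      ∀ x ∈ U, f x ≤ g x := by
  obtain ⟨J, hJ0, hJc, hJU, hJint, hJ⟩ := hU.exists_compact_exhaustion
  obtain ⟨δ, hδ, hδε⟩ := ENNReal.exists_pos_sum_of_countable' hε ℕ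
  have hJmono : Monotone J := monotone_nat_of_le_succ fun k => (hJint k).trans interior_subset
  have step : ∀ (k : ℕ) (F : EuclideanSpace ℝ (Fin n) → ℝ), (ConvexOn ℝ U F ∧
      (∀ x ∈ U, f x ≤ F x) ∧ ∀ x ∈ J k, HasSecondDiffBoundAt F x) →
      ∃ G : EuclideanSpace ℝ (Fin n) → ℝ, (ConvexOn ℝ U G ∧ (∀ x ∈ U, f x ≤ G x) ∧
        ∀ x ∈ J (k + 1), HasSecondDiffBoundAt G x) ∧ (∀ x ∈ J k, G x = F x) ∧
        volume {x ∈ U | G x ≠ F x} < δ k := by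
    rintro k F ⟨hF, hfF, hsd⟩
    obtain ⟨G, hG, hFG, hGsd, hGF, hvol⟩ := exists_convex_majorant_of_compact hU hne hF ha
      (fun x hx => (hab x hx).trans (hfF x hx)) (hJc (k + 2)) (hJU _) (hJc k)
      (hJmono (by omega)) hsd (hδ k).ne'
    exact ⟨G, ⟨hG, fun x hx => (hfF x hx).trans (hFG x hx), fun x hx => hGsd x (hJint _ hx)⟩,
      hGF, hvol⟩
  choose! next hnext using step
  let F : ℕ → EuclideanSpace ℝ (Fin n) → ℝ := fun k => Nat.rec f next k
  have hF : ∀ k, ConvexOn ℝ U (F k) ∧ (∀ x ∈ U, f x ≤ F k x) ∧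
      ∀ x ∈ J k, HasSecondDiffBoundAt (F k) x := by
    intro k
    induction k with
    | zero => exact ⟨hf, fun x _ => le_rfl, fun x hx => by simp [hJ0] at hx⟩
    | succ k ih => exact (hnext k (F k) ih).1
  have hstable : ∀ k m, k ≤ m → ∀ x ∈ J k, F m x = F k x := by
    intro k m hkm x hx
    induction m, hkm using Nat.le_induction with
    | base => rfl
    | succ m hkm ih => exact ((hnext m (F m) (hF m)).2.1 x (hJmono hkm hx)).trans ih
  choose! idx hidx using hJ
  have hg : ∀ k, ∀ x ∈ J k, F (idx x) x = F k x := fun k x hx =>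
    (hstable _ _ (le_max_left (idx x) k) x (hidx x (hJU k hx))).symm.trans
      (hstable _ _ (le_max_right _ _) x hx)
  refine ⟨fun x => F (idx x) x, ⟨hf.1, fun x hx y hy s t hs ht hst => ?_⟩, fun x hx => ?_, ?_,
    fun x hx => (hF _).2.1 x hx⟩
  · have hz := hf.1 hx hy hs ht hst
    set k := max (max (idx x) (idx y)) (idx (s • x + t • y))
    have hkx : x ∈ J k := hJmono (le_max_of_le_left (le_max_left _ _)) (hidx x hx)
    have hky : y ∈ J k := hJmono (le_max_of_le_left (le_max_right _ _)) (hidx y hy)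
    have hkz : s • x + t • y ∈ J k := hJmono (le_max_right _ _) (hidx _ hz)
    simp only [hg k _ hkx, hg k _ hky, hg k _ hkz]
    exact (hF k).1.2 hx hy hs ht hst
  · have hxint := hJint _ (hidx x hx)
    refine ((hF (idx x + 1)).2.2 x (interior_subset hxint)).congr ?_
    filter_upwards [isOpen_interior.mem_nhds hxint] with y hy
    exact (hg _ y (interior_subset hy)).symm
  · refine lt_of_le_of_lt ?_ hδε
    calc volume {x ∈ U | f x ≠ F (idx x) x}
        ≤ volume (⋃ k, {x ∈ U | F (k + 1) x ≠ F k x}) := by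
          refine measure_mono ?_
          rintro x ⟨hx, hne⟩
          by_contra h
          simp only [mem_iUnion, mem_ofPred_eq, not_exists, not_and, not_not] at h
          refine hne (Eq.symm ?_)
          have : ∀ k, F k x = f x := fun k => by
            induction k with
            | zero => rfl
            | succ k ih => exact (h k hx).trans ih
          exact this _
      _ ≤ ∑' k, volume {x ∈ U | F (k + 1) x ≠ F k x} := measure_iUnion_le _
      _ ≤ ∑' k, δ k := ENNReal.tsum_le_tsum fun k => (hnext k (F k) (hF k)).2.2.le

end Exhaustion

section Coercivity

variable {E : Type*} [NormedAddCommGroup E] [InnerProductSpace ℝ E]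

theorem HasSecondDiffBoundAt.add_inner {g : E → ℝ} {x : E} (h : HasSecondDiffBoundAt g x)
    (v : E) : HasSecondDiffBoundAt (fun y => g y + ⟪v, y⟫) x := by
  obtain ⟨Λ, r, hΛ, hr, h⟩ := h
  refine ⟨Λ, r, hΛ, hr, fun y hy u hu => ?_⟩
  have := h y hy u hu
  simp only [inner_add_right, inner_sub_right]
  linarith

/-- The slopes of the affine minorants of `f` on `U`. -/
def minorantSlopes (U : Set E) (f : E → ℝ) : Set E :=
  {p | ∃ b : ℝ, ∀ x ∈ U, ⟪p, x⟫ - b ≤ f x}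

variable {U : Set E} {f : E → ℝ}

theorem mem_minorantSlopes_of_subgradient {x p : E} (h : ∀ y ∈ U, f x + ⟪p, y - x⟫ ≤ f y) :
    p ∈ minorantSlopes U f :=
  ⟨⟪p, x⟫ - f x, fun y hy => by have := h y hy; rw [inner_sub_right] at this; linarith⟩

theorem convex_minorantSlopes : Convex ℝ (minorantSlopes U f) := by
  rintro p ⟨b, hb⟩ q ⟨c, hc⟩ s t hs ht hst
  refine ⟨s * b + t * c, fun x hx => ?_⟩
  rw [inner_add_left, real_inner_smul_left, real_inner_smul_left]
  have h1 := mul_le_mul_of_nonneg_left (hb x hx) hs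
  have h2 := mul_le_mul_of_nonneg_left (hc x hx) ht
  have h3 : s * f x + t * f x = f x := by rw [← add_mul, hst, one_mul]
  linarith

variable [FiniteDimensional ℝ E]

/-- If all slopes of affine minorants have the same component along `d`, then `U` is invariant
under translations along `d` and `f` is affine along `d`. -/
theorem line_of_inner_minorantSlopes_eq (hU : IsOpen U) (hf : ConvexOn ℝ U f) {d : E} {β : ℝ}
    (h : ∀ p ∈ minorantSlopes U f, ⟪p, d⟫ = β) {x : E} (hx : x ∈ U) (t : ℝ) :
    x + t • d ∈ U ∧ f (x + t • d) = f x + t * β := by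
  obtain ⟨p, hp⟩ := hf.exists_subgradient hU hx
  have hpS := mem_minorantSlopes_of_subgradient hp
  have hmem : x + t • d ∈ U := by
    by_contra hxt
    obtain ⟨u, hu⟩ := geometric_hahn_banach_open_point hf.1 hU hxt
    obtain ⟨w, rfl⟩ := (InnerProductSpace.toDual ℝ E).surjective u
    simp only [InnerProductSpace.toDual_apply_apply] at hu
    have h1 := hu x hx
    rw [inner_add_right, real_inner_smul_right] at h1
    obtain ⟨b, hb⟩ := hpS
    have h2 := h (p + w) ⟨b + ⟪w, x + t • d⟫, fun y hy => by
      rw [inner_add_left]; linarith [hb y hy, hu y hy]⟩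
    rw [inner_add_left, h p ⟨b, hb⟩, add_eq_left] at h2
    rw [h2] at h1
    linarith
  refine ⟨hmem, ?_⟩
  obtain ⟨q, hq⟩ := hf.exists_subgradient hU hmem
  have h1 := hp _ hmem
  have h2 := hq _ hx
  rw [add_sub_cancel_left, real_inner_smul_right, h p hpS] at h1
  rw [sub_add_cancel_left, inner_neg_right, real_inner_smul_right,
    h q (mem_minorantSlopes_of_subgradient hq)] at h2
  linarith

theorem Convex.exists_inner_eq_of_interior_eq_empty {S : Set E} (hS : Convex ℝ S)
    (hne : S.Nonempty) (hint : interior S = ∅) : ∃ d : E, d ≠ 0 ∧ ∃ β, ∀ p ∈ S, ⟪p, d⟫ = β := by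
  have h1 : affineSpan ℝ S ≠ ⊤ := fun h => by
    rw [← hS.interior_nonempty_iff_affineSpan_eq_top, hint] at h
    exact not_nonempty_empty h
  have h2 : vectorSpan ℝ S ≠ ⊤ := by
    rwa [← direction_affineSpan, Ne,
      AffineSubspace.direction_eq_top_iff_of_nonempty ((affineSpan_nonempty ℝ).2 hne)]
  rw [Ne, ← Submodule.orthogonal_eq_bot_iff] at h2
  obtain ⟨d, hd, hd0⟩ := Submodule.exists_mem_ne_zero_of_ne_bot h2
  obtain ⟨q, hq⟩ := hne
  refine ⟨d, hd0, ⟪q, d⟫, fun p hp => ?_⟩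
  have := (Submodule.mem_orthogonal _ _).1 hd _ (vsub_mem_vectorSpan ℝ hp hq)
  rwa [vsub_eq_sub, inner_sub_left, sub_eq_zero] at this

theorem exists_coercive_of_mem_interior_minorantSlopes {v : E}
    (hv : v ∈ interior (minorantSlopes U f)) :
    ∃ a b : ℝ, 0 < a ∧ ∀ x ∈ U, a * ‖x‖ - b ≤ f x - ⟪v, x⟫ := by
  obtain ⟨r, hr, hball⟩ := Metric.mem_nhds_iff.1 (mem_interior_iff_mem_nhds.1 hv)
  let e := stdOrthonormalBasis ℝ E
  have hmem : ∀ i, ∀ s : ℝ, |s| = r / 2 → v + s • e i ∈ minorantSlopes U f := fun i s hs =>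
    hball (by rw [mem_ball_iff_norm, add_sub_cancel_left, norm_smul, e.norm_eq_one,
      Real.norm_eq_abs, hs]; linarith)
  have hB : ∀ i, ∃ B : ℝ, ∀ x ∈ U, r / 2 * ‖⟪e i, x⟫‖ - B ≤ f x - ⟪v, x⟫ := fun i => by
    obtain ⟨b, hb⟩ := hmem i (r / 2) (abs_of_pos (by linarith))
    obtain ⟨c, hc⟩ := hmem i (-(r / 2)) (by rw [abs_neg, abs_of_pos (by linarith)])
    refine ⟨max b c, fun x hx => ?_⟩
    have h1 := hb x hx
    have h2 := hc x hx
    rw [inner_add_left, real_inner_smul_left] at h1 h2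
    rw [Real.norm_eq_abs]
    rcases abs_cases (⟪e i, x⟫) with ⟨h, -⟩ | ⟨h, -⟩ <;> rw [h] <;>
      linarith [le_max_left b c, le_max_right b c]
  choose B hB using hB
  obtain ⟨b, hb⟩ := interior_subset hv
  set N : ℝ := ((Finset.univ : Finset (Fin (Module.finrank ℝ E))).card : ℝ)
  have hN : 0 < N + 1 := by positivity
  refine ⟨r / 2 / (N + 1), (∑ i, B i + b) / (N + 1), by positivity, fun x hx => ?_⟩
  have h1 : ‖x‖ ≤ ∑ i, ‖⟪e i, x⟫‖ := by
    conv_lhs => rw [← e.sum_repr' x]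
    refine (norm_sum_le _ _).trans_eq (Finset.sum_congr rfl fun i _ => ?_)
    rw [norm_smul, e.norm_eq_one, mul_one]
  have h2 : ∑ i, (r / 2 * ‖⟪e i, x⟫‖ - B i) ≤ N * (f x - ⟪v, x⟫) := by
    rw [← nsmul_eq_mul]
    exact Finset.sum_le_card_nsmul _ _ _ fun i _ => hB i x hx
  rw [Finset.sum_sub_distrib, ← Finset.mul_sum] at h2
  have h3 := mul_le_mul_of_nonneg_left h1 (half_pos hr).le
  have h4 := hb x hx
  rw [div_mul_eq_mul_div, ← sub_div, div_le_iff₀ hN]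
  linarith

/-- A convex function whose graph contains no line is coercive up to a linear function. -/
theorem exists_coercive_of_no_line (hU : IsOpen U) (hne : U.Nonempty) (hf : ConvexOn ℝ U f)
    (h : ¬ ∃ (x d : E) (β : ℝ), d ≠ 0 ∧ ∀ t : ℝ, x + t • d ∈ U ∧ f (x + t • d) = f x + t * β) :
    ∃ (v : E) (a b : ℝ), 0 < a ∧ ∀ x ∈ U, a * ‖x‖ - b ≤ f x - ⟪v, x⟫ := by
  obtain ⟨x, hx⟩ := hne
  obtain ⟨p, hp⟩ := hf.exists_subgradient hU hx
  rcases (interior (minorantSlopes U f)).eq_empty_or_nonempty with h0 | ⟨v, hv⟩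
  · obtain ⟨d, hd, β, hβ⟩ := convex_minorantSlopes.exists_inner_eq_of_interior_eq_empty
      ⟨p, mem_minorantSlopes_of_subgradient hp⟩ h0
    exact absurd ⟨x, d, β, hd, line_of_inner_minorantSlopes_eq hU hf hβ hx⟩ h
  · exact ⟨v, exists_coercive_of_mem_interior_minorantSlopes hv⟩

end Coercivity

section Majorant

variable {n : ℕ}

theorem exists_C11_convex_majorant_of_no_line {U : Set (EuclideanSpace ℝ (Fin n))}
    {f : EuclideanSpace ℝ (Fin n) → ℝ} (hU : IsOpen U) (hne : U.Nonempty) (hf : ConvexOn ℝ U f)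
    (h : ¬ ∃ (x d : EuclideanSpace ℝ (Fin n)) (β : ℝ), d ≠ 0 ∧
      ∀ t : ℝ, x + t • d ∈ U ∧ f (x + t • d) = f x + t * β) {ε : ENNReal} (hε : ε ≠ 0) :
    ∃ g : EuclideanSpace ℝ (Fin n) → ℝ, ConvexOn ℝ U g ∧ IsC11LocOn U g ∧
      volume {x ∈ U | f x ≠ g x} < ε ∧ ∀ x ∈ U, f x ≤ g x := by
  obtain ⟨v, a, b, ha, hab⟩ := exists_coercive_of_no_line hU hne hf h
  have hlin : ∀ w : EuclideanSpace ℝ (Fin n), ConvexOn ℝ U fun x => ⟪w, x⟫ := fun w =>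
    (innerSL ℝ w).toLinearMap.convexOn hf.1
  have hf' : ConvexOn ℝ U fun x => f x - ⟪v, x⟫ :=
    (hf.add (hlin (-v))).congr fun x _ => by simp [sub_eq_add_neg]
  obtain ⟨g, hg, hgsd, hvol, hfg⟩ := exists_C11_convex_majorant_of_coercive hU hne hf' ha hab hε
  have hg' : ConvexOn ℝ U fun x => g x + ⟪v, x⟫ := hg.add (hlin v)
  refine ⟨fun x => g x + ⟪v, x⟫, hg', isC11LocOn_of_hasSecondDiffBoundAt hU hg'
    fun x hx => (hgsd x hx).add_inner v, ?_, fun x hx => by linarith [hfg x hx]⟩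
  simpa only [Ne, sub_eq_iff_eq_add] using hvol

end Majorant

section Rigidity

theorem IsC11LocOn.congr {n : ℕ} {U : Set (EuclideanSpace ℝ (Fin n))}
    {f g : EuclideanSpace ℝ (Fin n) → ℝ} (hU : IsOpen U) (hg : IsC11LocOn U g)
    (h : EqOn f g U) : IsC11LocOn U f := by
  obtain ⟨g', hg', hlip⟩ := hg
  exact ⟨g', fun x hx => (hg' x hx).congr_of_eventuallyEq (h.eventuallyEq_of_mem (hU.mem_nhds hx)),
    hlip⟩

theorem inner_eq_of_mem_minorantSlopes_of_line {E : Type*} [NormedAddCommGroup E]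
    [InnerProductSpace ℝ E] {U : Set E} {f : E → ℝ} {q v p : E} {β : ℝ}
    (h : ∀ t : ℝ, q + t • v ∈ U ∧ f (q + t • v) = f q + t * β) (hp : p ∈ minorantSlopes U f) :
    ⟪p, v⟫ = β := by
  obtain ⟨b, hb⟩ := hp
  have key : ∀ t : ℝ, t * (⟪p, v⟫ - β) ≤ f q + b - ⟪p, q⟫ := fun t => by
    have := hb _ (h t).1
    rw [(h t).2, inner_add_right, real_inner_smul_right] at this
    linarith
  by_contra hne
  have := key ((f q + b - ⟪p, q⟫ + 1) / (⟪p, v⟫ - β))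
  rw [div_mul_cancel₀ _ (sub_ne_zero.2 hne)] at this
  linarith

variable {E : Type*} [NormedAddCommGroup E] [InnerProductSpace ℝ E]

theorem ConvexOn.eq_of_eq_affine_at_three {U : Set E} {g : E → ℝ} {y w : E} {c β : ℝ}
    {k₁ k₂ k₃ : ℝ} (hg : ConvexOn ℝ U g) (hU : ∀ k : ℝ, y + k • w ∈ U) (h₁ : k₁ < 0)
    (h₂ : 0 < k₂) (h₃ : k₂ < k₃) (e₁ : g (y + k₁ • w) = c + k₁ * β)
    (e₂ : g (y + k₂ • w) = c + k₂ * β) (e₃ : g (y + k₃ • w) = c + k₃ * β) : g y = c := by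
  have hφ : ConvexOn ℝ univ fun k : ℝ => g (y + k • w) := by
    refine ⟨convex_univ, fun s _ t _ a b ha hb hab => ?_⟩
    have e : y + (a • s + b • t) • w = a • (y + s • w) + b • (y + t • w) := by
      have : y = (a + b) • y := by rw [hab, one_smul]
      nth_rewrite 1 [this]
      simp only [smul_eq_mul]
      module
    simp only [e]
    exact hg.2 (hU s) (hU t) ha hb hab
  have s1 := hφ.slope_mono_adjacent (mem_univ k₁) (mem_univ k₂) h₁ h₂
  have s2 := hφ.slope_mono_adjacent (mem_univ 0) (mem_univ k₃) h₂ h₃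
  simp only [zero_smul, add_zero, e₁, e₂, e₃] at s1 s2
  rw [div_le_div_iff₀ (by linarith) (by linarith)] at s1 s2
  have hle : g y ≤ c := by nlinarith
  have hge : c ≤ g y := by nlinarith
  exact le_antisymm hle hge

variable [FiniteDimensional ℝ E] [MeasurableSpace E] [BorelSpace E]

/-- A convex function agreeing up to finite measure with a convex function that is affine along `v`
agrees with it everywhere. -/
theorem eqOn_of_measure_ne_lt_top_of_invariant {μ : Measure E} [μ.IsAddHaarMeasure] {U : Set E}
    {f g : E → ℝ} {v : E} {β : ℝ} (hU : IsOpen U) (hf : ConvexOn ℝ U f) (hg : ConvexOn ℝ U g)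
    (hv : v ≠ 0) (hinv : ∀ y ∈ U, ∀ t : ℝ, y + t • v ∈ U ∧ f (y + t • v) = f y + t * β)
    (hμ : μ {x ∈ U | f x ≠ g x} ≠ ⊤) : EqOn f g U := by
  intro x hx
  by_contra hne
  set W : Set E := {x ∈ U | f x ≠ g x} with hW_def
  have hW : IsOpen W := by
    have := ((hf.continuousOn hU).sub (hg.continuousOn hU)).isOpen_inter_preimage hU
      (isOpen_compl_singleton (x := (0 : ℝ)))
    convert this using 1
    ext y
    simp [hW_def, sub_eq_zero]
  obtain ⟨r, hr, hball⟩ := Metric.isOpen_iff.1 hW x ⟨hx, hne⟩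
  have hv' : 0 < ‖v‖ := norm_pos_iff.2 hv
  set w : E := (2 * r / ‖v‖) • v with hw_def
  have hw : ‖w‖ = 2 * r := by
    rw [norm_smul, Real.norm_of_nonneg (by positivity)]; field_simp
  have hinv' : ∀ y ∈ U, ∀ k : ℝ, y + k • w ∈ U ∧
      f (y + k • w) = f y + k * (2 * r / ‖v‖ * β) := fun y hy k => by
    rw [hw_def, smul_smul, ← mul_assoc]
    exact hinv y hy _
  set D : ℤ → Set E := fun k => W ∩ Metric.ball (x + (k : ℝ) • w) r
  have hdisj : Pairwise (Function.onFun Disjoint D) := fun k j hkj => by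
    refine (Metric.ball_disjoint_ball ?_).mono inter_subset_right inter_subset_right
    have e : x + (k : ℝ) • w - (x + (j : ℝ) • w) = ((k - j : ℤ) : ℝ) • w := by
      push_cast; module
    have h1 : (1 : ℝ) ≤ |((k - j : ℤ) : ℝ)| := by
      exact_mod_cast Int.one_le_abs (sub_ne_zero.2 hkj)
    rw [dist_eq_norm, e, norm_smul, hw, Real.norm_eq_abs]
    nlinarith
  have hsum : ∑' k, μ (D k) ≠ ⊤ := by
    rw [← measure_iUnion hdisj fun k => (hW.inter Metric.isOpen_ball).measurableSet]
    exact ne_top_of_le_ne_top hμ (measure_mono (iUnion_subset fun k => inter_subset_left))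
  have hpos : 0 < μ (Metric.ball x r) / 3 :=
    ENNReal.div_pos (Metric.measure_ball_pos μ x hr).ne' (by norm_num)
  have hev := (ENNReal.tendsto_cofinite_zero_of_tsum_ne_top hsum).eventually_lt_const hpos
  rw [Int.cofinite_eq, eventually_sup] at hev
  obtain ⟨k₁, hk₁, h₁⟩ := (hev.1.and (eventually_lt_atBot 0)).exists
  obtain ⟨k₂, hk₂, h₂⟩ := (hev.2.and (eventually_gt_atTop 0)).exists
  obtain ⟨k₃, hk₃, h₃⟩ := (hev.2.and (eventually_gt_atTop k₂)).exists
  set A : ℤ → Set E := fun k => (fun y => y + (k : ℝ) • w) ⁻¹' D k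
  have hA : ∀ k, μ (A k) = μ (D k) := fun k => measure_preimage_add_right _ _ _
  obtain ⟨y, hy, hyA⟩ : ∃ y ∈ Metric.ball x r, y ∉ A k₁ ∪ A k₂ ∪ A k₃ := by
    by_contra! h
    refine (measure_mono (μ := μ) h).not_gt ?_
    calc μ (A k₁ ∪ A k₂ ∪ A k₃) ≤ μ (A k₁) + μ (A k₂) + μ (A k₃) :=
          (measure_union_le _ _).trans (add_le_add_left (measure_union_le _ _) _)
      _ < μ (Metric.ball x r) / 3 + μ (Metric.ball x r) / 3 + μ (Metric.ball x r) / 3 := by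
          rw [hA, hA, hA]
          exact ENNReal.add_lt_add (ENNReal.add_lt_add hk₁ hk₂) hk₃
      _ = μ (Metric.ball x r) := ENNReal.add_thirds _
  simp only [mem_union, not_or] at hyA
  obtain ⟨hyU, hfg⟩ := hball hy
  have hval : ∀ k : ℤ, y ∉ A k →
      g (y + (k : ℝ) • w) = f y + (k : ℝ) * (2 * r / ‖v‖ * β) := fun k hk => by
    rw [← (hinv' y hyU k).2]
    by_contra hne'
    refine hk ⟨⟨(hinv' y hyU k).1, Ne.symm hne'⟩, ?_⟩
    rw [Metric.mem_ball, dist_add_right]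
    exact hy
  exact hfg (hg.eq_of_eq_affine_at_three (fun k => (hinv' y hyU k).1) (Int.cast_lt_zero.2 h₁)
    (Int.cast_pos.2 h₂) (Int.cast_lt.2 h₃) (hval _ hyA.1.1) (hval _ hyA.1.2) (hval _ hyA.2)).symm

end Rigidity

section GraphLines

variable {E : Type*} [NormedAddCommGroup E] [NormedSpace ℝ E]

theorem exists_line_in_graph_iff {U : Set E} {f : E → ℝ} :
    (∃ p d : E × ℝ, d ≠ 0 ∧ ∀ t : ℝ, (p + t • d).1 ∈ U ∧ f (p + t • d).1 = (p + t • d).2) ↔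
      ∃ (x v : E) (β : ℝ), v ≠ 0 ∧ ∀ t : ℝ, x + t • v ∈ U ∧ f (x + t • v) = f x + t * β := by
  constructor
  · rintro ⟨⟨x, γ⟩, ⟨v, β⟩, hd, h⟩
    simp only [Prod.smul_mk, Prod.mk_add_mk, smul_eq_mul] at h
    have h0 : f x = γ := by simpa using (h 0).2
    refine ⟨x, v, β, ?_, fun t => by rw [h0]; exact h t⟩
    rintro rfl
    have h1 := (h 1).2
    simp only [smul_zero, add_zero, h0, one_mul, left_eq_add] at h1
    exact hd (by rw [h1]; rfl)
  · rintro ⟨x, v, β, hv, h⟩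
    exact ⟨(x, f x), (v, β), fun h0 => hv (congrArg Prod.fst h0), h⟩

end GraphLines

end Preliminaries

/-- **Theorem 1.** For a convex `f : U → ℝ` which is not `C¹'¹_loc`, Lusin approximation by
convex `C¹'¹_loc` functions is possible iff the graph of `f` contains no line; moreover, if
the graph contains no line, the approximating function can be taken `≥ f`. -/
theorem convex_lusin_C11_iff_no_line (n : ℕ) (U : Set (EuclideanSpace ℝ (Fin n)))
    (hUo : IsOpen U) (hUc : Convex ℝ U) (f : EuclideanSpace ℝ (Fin n) → ℝ)
    (hf : ConvexOn ℝ U f) (hnot : ¬ IsC11LocOn U f) :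
    ((∀ ε : ℝ, 0 < ε → ∃ g : EuclideanSpace ℝ (Fin n) → ℝ,
        ConvexOn ℝ U g ∧ IsC11LocOn U g ∧
        volume {x ∈ U | f x ≠ g x} < ENNReal.ofReal ε) ↔
      ¬ ∃ p d : (EuclideanSpace ℝ (Fin n)) × ℝ, d ≠ 0 ∧
          ∀ t : ℝ, (p + t • d).1 ∈ U ∧ f (p + t • d).1 = (p + t • d).2) ∧
    ((¬ ∃ p d : (EuclideanSpace ℝ (Fin n)) × ℝ, d ≠ 0 ∧
          ∀ t : ℝ, (p + t • d).1 ∈ U ∧ f (p + t • d).1 = (p + t • d).2) →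
      ∀ ε : ℝ, 0 < ε → ∃ g : EuclideanSpace ℝ (Fin n) → ℝ,
        ConvexOn ℝ U g ∧ IsC11LocOn U g ∧
        volume {x ∈ U | f x ≠ g x} < ENNReal.ofReal ε ∧
        ∀ x ∈ U, f x ≤ g x) := by
  have hne : U.Nonempty := by
    rw [nonempty_iff_ne_empty]
    rintro rfl
    exact hnot ⟨0, by simp, by simp⟩
  rw [exists_line_in_graph_iff]
  have hmajorant := fun h (ε : ℝ) (hε : 0 < ε) =>
    exists_C11_convex_majorant_of_no_line hUo hne hf h (ENNReal.ofReal_pos.2 hε).ne'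
  refine ⟨⟨?_, fun h ε hε => ?_⟩, hmajorant⟩
  · rintro h ⟨x, v, β, hv, hline⟩
    obtain ⟨g, hg, hgC, hvol⟩ := h 1 one_pos
    refine hnot (hgC.congr hUo (eqOn_of_measure_ne_lt_top_of_invariant hUo hf hg hv
      (fun y hy t => line_of_inner_minorantSlopes_eq hUo hf
        (fun p hp => inner_eq_of_mem_minorantSlopes_of_line hline hp) hy t)
      (hvol.trans ENNReal.ofReal_lt_top).ne))
  · obtain ⟨g, hg, hgC, hvol, -⟩ := hmajorant h ε hε
    exact ⟨g, hg, hgC, hvol⟩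
end
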